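/- arXiv:2301.09036 — 4 statements merged into one kernel-verified Lean document; each statement's English description precedes it below -/
import Mathlib

section
/- Let G be a finite simple 3-regular bipartite graph with m edges. Then M(G,3)·(m−3) = 4·M(G,4) + 2·N(P₂+2K₂) + N(P₃+K₂). -/
open SimpleGraph

/-- The number of `k`-matchings of a graph `G`: `k`-element sets of pairwise disjoint
edges of `G`, identified with the matching subgraphs of `G` having exactly `k` edges. -/
noncomputable def numMatchings {V : Type*} (G : SimpleGraph V) (k : ℕ) : ℕ :=
  Set.ncard {H : G.Subgraph | H.IsMatching ∧ H.edgeSet.ncard = k}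

/-- The number of subgraphs of `G` isomorphic to the graph `X`. -/
noncomputable def numSubgraphs {V W : Type*} (G : SimpleGraph V) (X : SimpleGraph W) : ℕ :=
  Set.ncard {H : G.Subgraph | Nonempty (H.coe ≃g X)}

open Finset

/-- Distinct members of `S` have no common vertex. -/
def EdgesDisjoint {V : Type*} (S : Finset (Sym2 V)) : Prop :=
  ∀ e ∈ S, ∀ f ∈ S, ∀ v, v ∈ e → v ∈ f → e = f

/-- `S` is the edge set of a path with two edges together with two disjoint edges. -/
def IsPathTwoAddEdges {V : Type*} [DecidableEq V] (S : Finset (Sym2 V)) : Prop :=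
  ∃ a b c d e f g : V, [a, b, c, d, e, f, g].Nodup ∧ S = {s(a, b), s(b, c), s(d, e), s(f, g)}

/-- `S` is the edge set of a path with three edges together with a disjoint edge. -/
def IsPathThreeAddEdge {V : Type*} [DecidableEq V] (S : Finset (Sym2 V)) : Prop :=
  ∃ a b c d e f : V, [a, b, c, d, e, f].Nodup ∧ S = {s(a, b), s(b, c), s(c, d), s(e, f)}

open Classical in
/-- The number of edges of `S` whose removal leaves pairwise disjoint edges. -/
noncomputable def numDisjointErase {V : Type*} (S : Finset (Sym2 V)) : ℕ :=
  #{e ∈ S | EdgesDisjoint (S.erase e)}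

lemma EdgesDisjoint.mono {V : Type*} {S T : Finset (Sym2 V)} (h : EdgesDisjoint T) (hST : S ⊆ T) :
    EdgesDisjoint S :=
  fun e he f hf v => h e (hST he) f (hST hf) v

lemma EdgesDisjoint.notMem_of_mem {V : Type*} {S : Finset (Sym2 V)} (h : EdgesDisjoint S)
    {e f : Sym2 V} (he : e ∈ S) (hf : f ∈ S) (hef : e ≠ f) :
    ∀ v ∈ e, v ∉ f :=
  fun v hv hvf => hef (h e he f hf v hv hvf)

section Combinatorics

variable {V : Type*} [DecidableEq V] {S : Finset (Sym2 V)}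

lemma EdgesDisjoint.numDisjointErase_eq (h : EdgesDisjoint S) : numDisjointErase S = #S := by
  classical
  unfold numDisjointErase
  rw [filter_true_of_mem fun e _ => ?_]
  convert h.mono (S.erase_subset e)

lemma IsPathTwoAddEdges.card_eq (h : IsPathTwoAddEdges S) : #S = 4 := by
  obtain ⟨a, b, c, d, e, f, g, hn, rfl⟩ := h
  simp only [List.nodup_cons, List.mem_cons, not_or] at hn
  repeat rw [card_insert_of_notMem (by simp; grind)]
  simp

lemma IsPathThreeAddEdge.card_eq (h : IsPathThreeAddEdge S) : #S = 4 := by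
  obtain ⟨a, b, c, d, e, f, hn, rfl⟩ := h
  simp only [List.nodup_cons, List.mem_cons, not_or] at hn
  repeat rw [card_insert_of_notMem (by simp; grind)]
  simp

lemma IsPathTwoAddEdges.numDisjointErase_eq (h : IsPathTwoAddEdges S) :
    numDisjointErase S = 2 := by
  classical
  obtain ⟨a, b, c, d, e, f, g, hn, rfl⟩ := h
  simp only [List.nodup_cons, List.mem_cons, not_or] at hn
  have hab : s(a, b) ≠ s(b, c) := by simp; grind
  unfold numDisjointErase
  rw [← card_pair hab]
  congr 1
  ext x
  simp only [mem_filter, mem_insert, mem_singleton]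
  constructor
  · rintro ⟨-, hx⟩
    by_contra! hne
    exact hab (hx _ (by simp [hne.1.symm]) _ (by simp [hne.2.symm]) b (by simp) (by simp))
  · rintro (rfl | rfl) <;> refine ⟨by simp, fun y hy z hz v hvy hvz => ?_⟩ <;>
      simp only [mem_erase, mem_insert, mem_singleton] at hy hz <;>
      obtain ⟨hy, rfl | rfl | rfl | rfl⟩ := hy <;> obtain ⟨hz, rfl | rfl | rfl | rfl⟩ := hz <;>
      simp only [Sym2.mem_iff] at hvy hvz <;> grind

lemma IsPathThreeAddEdge.numDisjointErase_eq (h : IsPathThreeAddEdge S) :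
    numDisjointErase S = 1 := by
  classical
  obtain ⟨a, b, c, d, e, f, hn, rfl⟩ := h
  simp only [List.nodup_cons, List.mem_cons, not_or] at hn
  have hab : s(a, b) ≠ s(b, c) := by simp; grind
  have hbc : s(b, c) ≠ s(c, d) := by simp; grind
  have hac : s(a, b) ≠ s(c, d) := by simp; grind
  unfold numDisjointErase
  rw [← card_singleton s(b, c)]
  congr 1
  ext x
  simp only [mem_filter, mem_insert, mem_singleton]
  constructor
  · rintro ⟨-, hx⟩
    by_contra! hne
    by_cases hxa : x = s(a, b)
    · exact hbc (hx _ (by simp [hne.symm]) _ (by simp [hxa, Ne.symm hac]) c (by simp) (by simp))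
    · exact hab (hx _ (by simp [Ne.symm hxa]) _ (by simp [hne.symm]) b (by simp) (by simp))
  · rintro rfl
    refine ⟨by simp, fun y hy z hz v hvy hvz => ?_⟩
    simp only [mem_erase, mem_insert, mem_singleton] at hy hz
    obtain ⟨hy, rfl | rfl | rfl | rfl⟩ := hy <;> obtain ⟨hz, rfl | rfl | rfl | rfl⟩ := hz <;>
      simp only [Sym2.mem_iff] at hvy hvz <;> grind

/-- Adding to three disjoint edges an edge that meets them in exactly one vertex. -/
lemma isPathTwoAddEdges_insert (hS : EdgesDisjoint S) (hcard : #S = 3)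
    (hdiag : ∀ e ∈ S, ¬ e.IsDiag) {x y z : V} (hxz : s(x, z) ∈ S)
    (hy : ∀ e ∈ S, y ∉ e) : IsPathTwoAddEdges (insert s(x, y) S) := by
  obtain ⟨g, h, hgh, hT⟩ := card_eq_two.mp (by rw [card_erase_of_mem hxz, hcard] :
    #(S.erase s(x, z)) = 2)
  have hSe : S = {s(x, z), g, h} := by rw [← insert_erase hxz, hT]
  have hg : g ∈ S.erase s(x, z) := by simp [hT]
  have hh : h ∈ S.erase s(x, z) := by simp [hT]
  rw [mem_erase] at hg hh
  have hdg := hS.notMem_of_mem hxz hg.2 hg.1.symm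
  have hdh := hS.notMem_of_mem hxz hh.2 hh.1.symm
  have hdgh := hS.notMem_of_mem hg.2 hh.2 hgh
  have h1 := hdiag _ hxz
  have h2 := hdiag _ hg.2
  have h3 := hdiag _ hh.2
  have hy1 := hy _ hxz
  have hy2 := hy _ hg.2
  have hy3 := hy _ hh.2
  subst hSe
  clear hy hS hdiag
  induction g with | _ p q
  induction h with | _ r t
  refine ⟨y, x, z, p, q, r, t, ?_, by rw [Sym2.eq_swap]⟩
  simp only [Sym2.mem_iff, Sym2.mk_isDiag_iff] at *
  grind

/-- Adding to three disjoint edges an edge that meets two of them. -/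
lemma isPathThreeAddEdge_insert (hS : EdgesDisjoint S) (hcard : #S = 3)
    (hdiag : ∀ e ∈ S, ¬ e.IsDiag) {x y z w : V} (hxy : x ≠ y) (hxz : s(x, z) ∈ S)
    (hyw : s(y, w) ∈ S) (hne : s(x, z) ≠ s(y, w)) :
    IsPathThreeAddEdge (insert s(x, y) S) := by
  have hyw' : s(y, w) ∈ S.erase s(x, z) := mem_erase.mpr ⟨hne.symm, hyw⟩
  obtain ⟨h, hT⟩ := card_eq_one.mp (by rw [card_erase_of_mem hyw', card_erase_of_mem hxz, hcard] :
    #((S.erase s(x, z)).erase s(y, w)) = 1)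
  have hSe : S = {s(x, z), s(y, w), h} := by rw [← insert_erase hxz, ← insert_erase hyw', hT]
  have hh : h ∈ (S.erase s(x, z)).erase s(y, w) := by simp [hT]
  rw [mem_erase, mem_erase] at hh
  have hd := hS.notMem_of_mem hxz hyw hne
  have hdx := hS.notMem_of_mem hxz hh.2.2 hh.2.1.symm
  have hdy := hS.notMem_of_mem hyw hh.2.2 hh.1.symm
  have h1 := hdiag _ hxz
  have h2 := hdiag _ hyw
  have h3 := hdiag _ hh.2.2
  subst hSe
  clear hS hdiag
  induction h with | _ r t
  refine ⟨z, x, y, w, r, t, ?_, by rw [Sym2.eq_swap (a := z), insert_comm]⟩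
  simp only [Sym2.mem_iff, Sym2.mk_isDiag_iff] at *
  grind

lemma edgesDisjoint_or_of_erase (hcard : #S = 4) (hdiag : ∀ e ∈ S, ¬ e.IsDiag) {e : Sym2 V}
    (he : e ∈ S) (hS : EdgesDisjoint (S.erase e)) :
    EdgesDisjoint S ∨ IsPathTwoAddEdges S ∨ IsPathThreeAddEdge S := by
  have hcard' : #(S.erase e) = 3 := by rw [card_erase_of_mem he, hcard]
  have hdiag' : ∀ f ∈ S.erase e, ¬ f.IsDiag := fun f hf => hdiag f (mem_of_mem_erase hf)
  have hins := insert_erase he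
  have hed := hdiag e he
  have hnot := S.notMem_erase e
  generalize S.erase e = T at *
  subst hins
  induction e with | _ x y
  rw [Sym2.mk_isDiag_iff] at hed
  by_cases hx : ∃ f ∈ T, x ∈ f
  · obtain ⟨f, hf, hxf⟩ := hx
    obtain ⟨z, rfl⟩ := hxf
    by_cases hy : ∃ f ∈ T, y ∈ f
    · obtain ⟨g, hg, hyg⟩ := hy
      obtain ⟨w, rfl⟩ := hyg
      refine .inr (.inr (isPathThreeAddEdge_insert hS hcard' hdiag' hed hf hg fun h => ?_))
      have : y = z := by
        simp only [Sym2.eq_iff] at h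
        grind
      exact hnot (this ▸ hf)
    · push Not at hy
      exact .inr (.inl (isPathTwoAddEdges_insert hS hcard' hdiag' hf hy))
  · push Not at hx
    by_cases hy : ∃ f ∈ T, y ∈ f
    · obtain ⟨g, hg, hyg⟩ := hy
      obtain ⟨w, rfl⟩ := hyg
      rw [Sym2.eq_swap (a := x)]
      exact .inr (.inl (isPathTwoAddEdges_insert hS hcard' hdiag' hg hx))
    · push Not at hy
      left
      intro f hf g hg v hvf hvg
      rw [mem_insert] at hf hg
      rcases hf with rfl | hf <;> rcases hg with rfl | hg
      · rfl
      · rcases Sym2.mem_iff.mp hvf with rfl | rfl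
        exacts [(hx _ hg hvg).elim, (hy _ hg hvg).elim]
      · rcases Sym2.mem_iff.mp hvg with rfl | rfl
        exacts [(hx _ hf hvf).elim, (hy _ hf hvf).elim]
      · exact hS f hf g hg v hvf hvg

open Classical in
lemma numDisjointErase_eq_add (hcard : #S = 4) (hdiag : ∀ e ∈ S, ¬ e.IsDiag) :
    numDisjointErase S = 4 * (if EdgesDisjoint S then 1 else 0) +
      2 * (if IsPathTwoAddEdges S then 1 else 0) + (if IsPathThreeAddEdge S then 1 else 0) := by
  have h4 : EdgesDisjoint S → numDisjointErase S = 4 := fun h => h.numDisjointErase_eq.trans hcard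
  have h2 : IsPathTwoAddEdges S → numDisjointErase S = 2 := fun h => h.numDisjointErase_eq
  have h1 : IsPathThreeAddEdge S → numDisjointErase S = 1 := fun h => h.numDisjointErase_eq
  have h0 : numDisjointErase S ≠ 0 →
      EdgesDisjoint S ∨ IsPathTwoAddEdges S ∨ IsPathThreeAddEdge S := by
    intro h
    obtain ⟨e, he⟩ := card_ne_zero.mp h
    rw [mem_filter] at he
    refine edgesDisjoint_or_of_erase hcard hdiag he.1 ?_
    convert he.2
  split_ifs <;> grind

open Classical in
lemma card_edgesDisjoint_mul (E : Finset (Sym2 V)) (k : ℕ) :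
    #{M ∈ E.powersetCard k | EdgesDisjoint M} * (#E - k) =
      ∑ T ∈ E.powersetCard (k + 1), numDisjointErase T := by
  have hl : #{M ∈ E.powersetCard k | EdgesDisjoint M} * (#E - k) =
      #(({M ∈ E.powersetCard k | EdgesDisjoint M}).sigma fun M => E \ M) := by
    rw [card_sigma, ← smul_eq_mul, ← sum_const]
    refine sum_congr rfl fun M hM => ?_
    rw [mem_filter, mem_powersetCard] at hM
    rw [card_sdiff_of_subset hM.1.1, hM.1.2]
  have hr : ∑ T ∈ E.powersetCard (k + 1), numDisjointErase T =
      #((E.powersetCard (k + 1)).sigma fun T => {e ∈ T | EdgesDisjoint (T.erase e)}) := by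
    rw [card_sigma]
    refine sum_congr rfl fun T _ => ?_
    unfold numDisjointErase
    congr!
  rw [hl, hr]
  refine card_nbij' (fun p => ⟨insert p.2 p.1, p.2⟩) (fun p => ⟨p.1.erase p.2, p.2⟩) ?_ ?_ ?_ ?_
  · rintro ⟨M, e⟩ h
    simp only [coe_sigma, Set.mem_sigma_iff, mem_coe, mem_filter, mem_powersetCard,
      mem_sdiff] at h ⊢
    obtain ⟨⟨⟨hME, hc⟩, hM⟩, he, heM⟩ := h
    refine ⟨⟨insert_subset he hME, by rw [card_insert_of_notMem heM, hc]⟩, by simp, ?_⟩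
    rwa [erase_insert heM]
  · rintro ⟨T, e⟩ h
    simp only [coe_sigma, Set.mem_sigma_iff, mem_coe, mem_filter, mem_powersetCard,
      mem_sdiff] at h ⊢
    obtain ⟨⟨hTE, hc⟩, he, hT⟩ := h
    exact ⟨⟨⟨(T.erase_subset e).trans hTE, by rw [card_erase_of_mem he, hc]; rfl⟩, hT⟩, hTE he,
      T.notMem_erase e⟩
  · rintro ⟨M, e⟩ h
    simp only [coe_sigma, Set.mem_sigma_iff, mem_coe, mem_sdiff] at h
    simp [erase_insert h.2.2]
  · rintro ⟨T, e⟩ h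
    simp only [coe_sigma, Set.mem_sigma_iff, mem_coe, mem_filter] at h
    simp [insert_erase h.2.1]

end Combinatorics

section Subgraphs

variable {V W : Type*} {G : SimpleGraph V}

lemma subgraph_edgeSet_injOn :
    Set.InjOn Subgraph.edgeSet {H : G.Subgraph | H.verts ⊆ H.support} := by
  intro H hH K hK h
  have hadj : H.Adj = K.Adj := by
    ext v w
    rw [← Subgraph.mem_edgeSet, h, Subgraph.mem_edgeSet]
  refine Subgraph.ext ?_ hadj
  rw [hH.antisymm H.support_subset_verts, hK.antisymm K.support_subset_verts]
  ext v
  simp only [Subgraph.mem_support, hadj]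

lemma exists_subgraph_edgeSet_eq {S : Set (Sym2 V)} (hS : S ⊆ G.edgeSet) :
    ∃ H : G.Subgraph, H.edgeSet = S ∧ H.verts ⊆ H.support := by
  refine ⟨{ verts := {v | ∃ w, s(v, w) ∈ S}
            Adj := fun v w => s(v, w) ∈ S
            adj_sub := fun h => hS h
            edge_vert := fun h => ⟨_, h⟩
            symm := ⟨fun v w h => by rwa [Sym2.eq_swap]⟩ }, ?_, fun v hv => hv⟩
  ext e
  induction e with | _ v w
  simp

/-- Subgraphs without isolated vertices may be counted through their edge sets. -/
lemma ncard_subgraph_eq_card {P : Set G.Subgraph} (hP : ∀ H ∈ P, H.verts ⊆ H.support)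
    {F : Finset (Finset (Sym2 V))} (hPF : ∀ H ∈ P, ∃ S ∈ F, (S : Set (Sym2 V)) = H.edgeSet)
    (hFP : ∀ S ∈ F, ∃ H ∈ P, H.edgeSet = S) : P.ncard = #F := by
  rw [← Set.ncard_coe_finset, ← (subgraph_edgeSet_injOn.mono hP).ncard_image,
    ← Set.ncard_image_of_injective (F : Set (Finset (Sym2 V))) coe_injective]
  congr 1
  ext T
  constructor
  · rintro ⟨H, hH, rfl⟩
    exact hPF H hH
  · rintro ⟨S, hS, rfl⟩
    exact hFP S hS

lemma exists_finset_eq_edgeSet [Fintype G.edgeSet] (H : G.Subgraph) :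
    ∃ S ⊆ G.edgeFinset, (S : Set (Sym2 V)) = H.edgeSet := by
  have hfin : H.edgeSet.Finite := (Set.toFinite G.edgeSet).subset H.edgeSet_subset
  refine ⟨hfin.toFinset, ?_, hfin.coe_toFinset⟩
  rw [← coe_subset, hfin.coe_toFinset, coe_edgeFinset]
  exact H.edgeSet_subset

lemma isMatching_iff {H : G.Subgraph} {S : Finset (Sym2 V)} (hv : H.verts ⊆ H.support)
    (hS : (S : Set (Sym2 V)) = H.edgeSet) : H.IsMatching ↔ EdgesDisjoint S := by
  have hmem : ∀ e, e ∈ S ↔ e ∈ H.edgeSet := fun e => by rw [← hS, mem_coe]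
  constructor
  · rintro hM e he f hf v ⟨x, rfl⟩ ⟨y, rfl⟩
    rw [hmem, Subgraph.mem_edgeSet] at he hf
    rw [(hM (H.edge_vert he)).unique he hf]
  · intro hD v hvH
    obtain ⟨w, hw⟩ := hv hvH
    refine ⟨w, hw, fun y hy => ?_⟩
    have := hD s(v, y) ((hmem _).mpr hy) s(v, w) ((hmem _).mpr hw) v (by simp) (by simp)
    exact Sym2.congr_right.mp this

open Classical in
lemma numMatchings_eq_card [Fintype G.edgeSet] (k : ℕ) :
    numMatchings G k = #{M ∈ G.edgeFinset.powersetCard k | EdgesDisjoint M} := by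
  refine ncard_subgraph_eq_card ?_ ?_ ?_
  · rintro H ⟨hH, -⟩
    exact hH.support_eq_verts.ge
  · rintro H ⟨hH, hk⟩
    obtain ⟨S, hSE, hS⟩ := exists_finset_eq_edgeSet H
    refine ⟨S, mem_filter.mpr ⟨mem_powersetCard.mpr ⟨hSE, ?_⟩, ?_⟩, hS⟩
    · rw [← hk, ← hS, Set.ncard_coe_finset]
    · exact (isMatching_iff hH.support_eq_verts.ge hS).mp hH
  · intro S hS
    rw [mem_filter, mem_powersetCard] at hS
    obtain ⟨H, hHS, hv⟩ := exists_subgraph_edgeSet_eq (G := G) (S := S)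
      (by rw [← coe_edgeFinset]; exact_mod_cast hS.1.1)
    refine ⟨H, ⟨(isMatching_iff hv hHS.symm).mpr hS.2, ?_⟩, hHS⟩
    rw [hHS, Set.ncard_coe_finset, hS.1.2]

lemma numMatchings_eq_zero [Fintype G.edgeSet] {k : ℕ} (hk : #G.edgeFinset < k) :
    numMatchings G k = 0 := by
  classical
  rw [numMatchings_eq_card, powersetCard_eq_empty.mpr hk, filter_empty, card_empty]

lemma copy_toSubgraph_edgeSet {X : SimpleGraph W} (f : X.Copy G) :
    f.toSubgraph.edgeSet = Sym2.map f '' X.edgeSet := by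
  simp [Subgraph.edgeSet_map]

lemma copy_toSubgraph_verts_subset {X : SimpleGraph W} (hX : ∀ v, ∃ w, X.Adj v w)
    (f : X.Copy G) : f.toSubgraph.verts ⊆ f.toSubgraph.support := by
  rintro _ ⟨v, -, rfl⟩
  obtain ⟨w, hw⟩ := hX v
  exact ⟨f w, v, w, hw, rfl, rfl⟩

open Classical in
lemma numSubgraphs_eq_card [Fintype G.edgeSet] {X : SimpleGraph W} (hX : ∀ v, ∃ w, X.Adj v w) :
    numSubgraphs G X = #(G.edgeFinset.powerset.filter fun S : Finset (Sym2 V) =>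
      ∃ f : X.Copy G, (S : Set (Sym2 V)) = Sym2.map f '' X.edgeSet) := by
  have hcopy : ∀ H : G.Subgraph, Nonempty (H.coe ≃g X) ↔ ∃ f : X.Copy G, f.toSubgraph = H := by
    intro H
    have := Set.ext_iff.mp (Copy.range_toSubgraph (A := X) (B := G)) H
    rw [Set.mem_range] at this
    rw [this]
    exact ⟨fun ⟨e⟩ => ⟨e.symm⟩, fun ⟨e⟩ => ⟨e.symm⟩⟩
  refine ncard_subgraph_eq_card ?_ ?_ ?_
  · intro H hH
    obtain ⟨f, rfl⟩ := (hcopy H).mp hH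
    exact copy_toSubgraph_verts_subset hX f
  · intro H hH
    obtain ⟨f, rfl⟩ := (hcopy H).mp hH
    obtain ⟨S, hSE, hS⟩ := exists_finset_eq_edgeSet f.toSubgraph
    exact ⟨S, mem_filter.mpr ⟨mem_powerset.mpr hSE, f, hS.trans (copy_toSubgraph_edgeSet f)⟩, hS⟩
  · intro S hS
    obtain ⟨-, f, hf⟩ := mem_filter.mp hS
    exact ⟨f.toSubgraph, (hcopy _).mpr ⟨f, rfl⟩, (copy_toSubgraph_edgeSet f).trans hf.symm⟩

lemma pathGraph_exists_adj {n : ℕ} (hn : 2 ≤ n) (v : Fin n) : ∃ w, (pathGraph n).Adj v w := by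
  simp only [pathGraph_adj]
  by_cases hv : v.val + 1 < n
  · exact ⟨⟨v + 1, hv⟩, .inl rfl⟩
  · exact ⟨⟨v - 1, by omega⟩, .inr (by simp; omega)⟩

lemma sum_exists_adj {U : Type*} {X : SimpleGraph W} {Y : SimpleGraph U}
    (hX : ∀ v, ∃ w, X.Adj v w) (hY : ∀ v, ∃ w, Y.Adj v w) (v : W ⊕ U) :
    ∃ w, (X ⊕g Y).Adj v w := by
  rcases v with v | v
  · obtain ⟨w, hw⟩ := hX v
    exact ⟨.inl w, hw⟩
  · obtain ⟨w, hw⟩ := hY v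
    exact ⟨.inr w, hw⟩

lemma sum_edgeSet {U : Type*} (X : SimpleGraph W) (Y : SimpleGraph U) :
    (X ⊕g Y).edgeSet = Sym2.map .inl '' X.edgeSet ∪ Sym2.map .inr '' Y.edgeSet := by
  ext e
  induction e with | _ v w
  rcases v with v | v <;> rcases w with w | w <;>
    simp [Sym2.exists, adj_comm] <;> grind [adj_comm]

lemma pathGraph_two_edgeSet : (pathGraph 2).edgeSet = {s(0, 1)} := by
  ext e
  induction e with | _ v w
  fin_cases v <;> fin_cases w <;> simp [pathGraph_adj]

lemma pathGraph_three_edgeSet : (pathGraph 3).edgeSet = {s(0, 1), s(1, 2)} := by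
  ext e
  induction e with | _ v w
  fin_cases v <;> fin_cases w <;> simp [pathGraph_adj]

lemma pathGraph_four_edgeSet : (pathGraph 4).edgeSet = {s(0, 1), s(1, 2), s(2, 3)} := by
  ext e
  induction e with | _ v w
  fin_cases v <;> fin_cases w <;> simp [pathGraph_adj]

/-- An injective map sending edges to edges is a copy. -/
lemma exists_copy_of_image_subset {X : SimpleGraph W} {f : W → V} (hf : Function.Injective f)
    (h : Sym2.map f '' X.edgeSet ⊆ G.edgeSet) : ∃ g : X.Copy G, ⇑g = f :=
  ⟨⟨⟨f, fun {v w} hvw => h ⟨s(v, w), hvw, rfl⟩⟩, hf⟩, rfl⟩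

open Classical in
lemma card_filter_powerset_eq {V : Type*} {E : Finset (Sym2 V)} {k : ℕ}
    {P Q : Finset (Sym2 V) → Prop}
    (hPQ : ∀ S ⊆ E, P S ↔ Q S) (hQ : ∀ S, Q S → #S = k) :
    #{S ∈ E.powerset | P S} = #{S ∈ E.powersetCard k | Q S} := by
  congr 1
  ext S
  simp only [mem_filter, mem_powerset, mem_powersetCard]
  grind

variable [DecidableEq V]

lemma exists_copy_iff_isPathTwoAddEdges {S : Finset (Sym2 V)}
    (hS : (S : Set (Sym2 V)) ⊆ G.edgeSet) :
    (∃ f : (pathGraph 3 ⊕g pathGraph 2 ⊕g pathGraph 2).Copy G, (S : Set (Sym2 V)) =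
      Sym2.map f '' (pathGraph 3 ⊕g pathGraph 2 ⊕g pathGraph 2).edgeSet) ↔
      IsPathTwoAddEdges S := by
  simp only [sum_edgeSet, pathGraph_two_edgeSet, pathGraph_three_edgeSet]
  constructor
  · rintro ⟨f, hf⟩
    refine ⟨f (.inl (.inl 0)), f (.inl (.inl 1)), f (.inl (.inl 2)), f (.inl (.inr 0)),
      f (.inl (.inr 1)), f (.inr 0), f (.inr 1), ?_, ?_⟩
    · have hinj : Function.Injective f := f.injective
      simp [hinj.eq_iff]
    · apply coe_injective
      rw [hf]
      ext e
      simp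
      tauto
  · rintro ⟨a, b, c, d, e, f, g, hn, rfl⟩
    simp only [List.nodup_cons, List.mem_cons, not_or] at hn
    have himg : Sym2.map (Sum.elim (Sum.elim ![a, b, c] ![d, e]) ![f, g]) ''
        (pathGraph 3 ⊕g pathGraph 2 ⊕g pathGraph 2).edgeSet =
        ({s(a, b), s(b, c), s(d, e), s(f, g)} : Finset (Sym2 V)) := by
      simp only [sum_edgeSet, pathGraph_two_edgeSet, pathGraph_three_edgeSet]
      ext x
      simp
      tauto
    obtain ⟨φ, hφ⟩ := exists_copy_of_image_subset (G := G)
      (X := pathGraph 3 ⊕g pathGraph 2 ⊕g pathGraph 2)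
      (f := Sum.elim (Sum.elim ![a, b, c] ![d, e]) ![f, g]) (by
        rintro ((x | x) | x) ((y | y) | y) <;> fin_cases x <;> fin_cases y <;> simp <;> grind)
      (himg ▸ hS)
    refine ⟨φ, ?_⟩
    rw [hφ, ← himg]
    simp only [sum_edgeSet, pathGraph_two_edgeSet, pathGraph_three_edgeSet]

lemma exists_copy_iff_isPathThreeAddEdge {S : Finset (Sym2 V)}
    (hS : (S : Set (Sym2 V)) ⊆ G.edgeSet) :
    (∃ f : (pathGraph 4 ⊕g pathGraph 2).Copy G, (S : Set (Sym2 V)) =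
      Sym2.map f '' (pathGraph 4 ⊕g pathGraph 2).edgeSet) ↔ IsPathThreeAddEdge S := by
  simp only [sum_edgeSet, pathGraph_two_edgeSet, pathGraph_four_edgeSet]
  constructor
  · rintro ⟨f, hf⟩
    refine ⟨f (.inl 0), f (.inl 1), f (.inl 2), f (.inl 3), f (.inr 0), f (.inr 1), ?_, ?_⟩
    · have hinj : Function.Injective f := f.injective
      simp [hinj.eq_iff]
    · apply coe_injective
      rw [hf]
      ext e
      simp
      tauto
  · rintro ⟨a, b, c, d, e, f, hn, rfl⟩
    simp only [List.nodup_cons, List.mem_cons, not_or] at hn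
    have himg : Sym2.map (Sum.elim ![a, b, c, d] ![e, f]) ''
        (pathGraph 4 ⊕g pathGraph 2).edgeSet =
        ({s(a, b), s(b, c), s(c, d), s(e, f)} : Finset (Sym2 V)) := by
      simp only [sum_edgeSet, pathGraph_two_edgeSet, pathGraph_four_edgeSet]
      ext x
      simp
      tauto
    obtain ⟨φ, hφ⟩ := exists_copy_of_image_subset (G := G) (X := pathGraph 4 ⊕g pathGraph 2)
      (f := Sum.elim ![a, b, c, d] ![e, f]) (by
        rintro (x | x) (y | y) <;> fin_cases x <;> fin_cases y <;> simp <;> grind)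
      (himg ▸ hS)
    refine ⟨φ, ?_⟩
    rw [hφ, ← himg]
    simp only [sum_edgeSet, pathGraph_two_edgeSet, pathGraph_four_edgeSet]

open Classical in
lemma numSubgraphs_pathTwoAddEdges [Fintype G.edgeSet] :
    numSubgraphs G (pathGraph 3 ⊕g pathGraph 2 ⊕g pathGraph 2) =
      #{S ∈ G.edgeFinset.powersetCard 4 | IsPathTwoAddEdges S} := by
  rw [numSubgraphs_eq_card (sum_exists_adj (sum_exists_adj (pathGraph_exists_adj (by norm_num))
    (pathGraph_exists_adj le_rfl)) (pathGraph_exists_adj le_rfl))]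
  refine card_filter_powerset_eq (fun S hS => exists_copy_iff_isPathTwoAddEdges ?_)
    fun S h => IsPathTwoAddEdges.card_eq h
  rw [← coe_edgeFinset]
  exact_mod_cast hS

open Classical in
lemma numSubgraphs_pathThreeAddEdge [Fintype G.edgeSet] :
    numSubgraphs G (pathGraph 4 ⊕g pathGraph 2) =
      #{S ∈ G.edgeFinset.powersetCard 4 | IsPathThreeAddEdge S} := by
  rw [numSubgraphs_eq_card (sum_exists_adj (pathGraph_exists_adj (by norm_num))
    (pathGraph_exists_adj le_rfl))]
  refine card_filter_powerset_eq (fun S hS => exists_copy_iff_isPathThreeAddEdge ?_)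
    fun S h => IsPathThreeAddEdge.card_eq h
  rw [← coe_edgeFinset]
  exact_mod_cast hS

lemma numMatchings_three_mul [Fintype G.edgeSet] :
    numMatchings G 3 * (#G.edgeFinset - 3) =
      4 * numMatchings G 4 + 2 * numSubgraphs G (pathGraph 3 ⊕g pathGraph 2 ⊕g pathGraph 2) +
        numSubgraphs G (pathGraph 4 ⊕g pathGraph 2) := by
  classical
  rw [numMatchings_eq_card, card_edgesDisjoint_mul, numMatchings_eq_card,
    numSubgraphs_pathTwoAddEdges, numSubgraphs_pathThreeAddEdge, card_filter, card_filter,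
    card_filter, mul_sum, mul_sum, ← sum_add_distrib, ← sum_add_distrib]
  refine sum_congr rfl fun S hS => ?_
  rw [mem_powersetCard] at hS
  exact numDisjointErase_eq_add hS.2 fun e he =>
    G.not_isDiag_of_mem_edgeSet (mem_edgeFinset.mp (hS.1 he))

end Subgraphs

theorem stmt_7 {V : Type*} [Fintype V] [DecidableEq V] (G : SimpleGraph V) [DecidableRel G.Adj]
    (hreg : G.IsRegularOfDegree 3) (hbip : G.Colorable 2) :
    (numMatchings G 3 : ℤ) * ((G.edgeFinset.card : ℤ) - 3) =
      4 * numMatchings G 4 + 2 * numSubgraphs G (pathGraph 3 ⊕g pathGraph 2 ⊕g pathGraph 2) + numSubgraphs G (pathGraph 4 ⊕g pathGraph 2) := by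
  have h := numMatchings_three_mul (G := G)
  rcases lt_or_ge #G.edgeFinset 3 with hm | hm
  · rw [numMatchings_eq_zero hm] at h ⊢
    push_cast
    lia
  · have h' := congrArg (Nat.cast (R := ℤ)) h
    push_cast [Nat.cast_sub hm] at h'
    exact h'
end

section
/- Let G be a finite simple 3-regular bipartite graph. Then 12·M(G,3) = 2·N(P₂+2K₂) + 2·N(P₃+K₂). -/
open SimpleGraph

namespace SimpleGraph

variable {V W : Type*}

/-- A labelled copy of `X` in `G` amounts to a subgraph of `G` with an isomorphism from `X`. -/
theorem Copy.sigma_iso_bijective (G : SimpleGraph V) (X : SimpleGraph W) :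
    Function.Bijective
      (fun p : (Σ H : G.Subgraph, X ≃g H.coe) ↦ p.1.coeCopy.comp p.2.toCopy) := by
  have key (H : G.Subgraph) (e : X ≃g H.coe) :
      (H.coeCopy.comp e.toCopy).toSubgraph = H := by
    ext x y
    · simp only [Copy.toSubgraph, Subgraph.map_verts, Subgraph.verts_top, Set.image_univ,
        Set.mem_range]
      exact ⟨fun ⟨w, hw⟩ ↦ hw ▸ (e w).2, fun hx ↦ ⟨e.symm ⟨x, hx⟩, by simp [Subgraph.coeCopy]⟩⟩
    · simp only [Copy.toSubgraph, Subgraph.map_adj, Subgraph.top_adj, Relation.map_apply]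
      constructor
      · rintro ⟨a, b, hab, rfl, rfl⟩
        exact e.map_adj_iff.2 hab
      · intro h
        refine ⟨e.symm ⟨x, h.fst_mem⟩, e.symm ⟨y, h.snd_mem⟩, ?_, ?_, ?_⟩
        · exact e.symm.map_adj_iff.2 h
        · simp [Subgraph.coeCopy]
        · simp [Subgraph.coeCopy]
  constructor
  · rintro ⟨H, e⟩ ⟨H', e'⟩ h
    dsimp only at h
    obtain rfl : H = H' := by rw [← key H e, h, key]
    congr
    ext w
    exact DFunLike.congr_fun h w
  · intro f
    exact ⟨⟨f.toSubgraph, f.isoToSubgraph⟩, Copy.ext fun _ ↦ rfl⟩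

theorem Copy.bijective_isoToCopy [Finite W] (X : SimpleGraph W) :
    Function.Bijective (Iso.toCopy : (X ≃g X) → Copy X X) := by
  constructor
  · intro e e' h
    ext w
    exact DFunLike.congr_fun h w
  · intro f
    have hb : Function.Bijective f := Finite.injective_iff_bijective.1 f.injective
    let s : Set (W × W) := {p | X.Adj p.1 p.2}
    have hs : Set.SurjOn (Prod.map f f) s s := by
      have himg : Prod.map f f '' s ⊆ s := by
        rintro _ ⟨p, hp, rfl⟩
        exact f.toHom.map_adj hp
      exact (Set.eq_of_subset_of_ncard_le himg
        (Set.ncard_image_of_injective s (f.injective.prodMap f.injective)).ge s.toFinite).ge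
    refine ⟨⟨Equiv.ofBijective f hb, fun {a b} ↦ ⟨fun h ↦ ?_, f.toHom.map_adj⟩⟩, ?_⟩
    · obtain ⟨⟨c, d⟩, hcd, h'⟩ := hs (show (f a, f b) ∈ s from h)
      simp only [Prod.map_apply, Prod.mk.injEq] at h'
      rw [← f.injective h'.1, ← f.injective h'.2]
      exact hcd
    · exact Copy.ext fun _ ↦ rfl

theorem card_copy_eq_numSubgraphs_mul [Finite V] [Finite W] (G : SimpleGraph V)
    (X : SimpleGraph W) :
    Nat.card (Copy X G) = numSubgraphs G X * Nat.card (Copy X X) := by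
  classical
  have := Fintype.ofFinite V
  have := Fintype.ofFinite G.Subgraph
  have h (H : G.Subgraph) : Nat.card (X ≃g H.coe) =
      if Nonempty (H.coe ≃g X) then Nat.card (Copy X X) else 0 := by
    split_ifs with hH
    · obtain ⟨e⟩ := hH
      rw [← Nat.card_eq_of_bijective _ (Copy.bijective_isoToCopy X)]
      exact Nat.card_congr ⟨fun f ↦ f.trans e, fun f ↦ f.trans e.symm,
        fun f ↦ by ext; simp, fun f ↦ by ext; simp⟩
    · have : IsEmpty (X ≃g H.coe) := ⟨fun e ↦ hH ⟨e.symm⟩⟩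
      exact Nat.card_of_isEmpty
  have (H : G.Subgraph) : Finite (X ≃g H.coe) := Finite.of_injective _ DFunLike.coe_injective
  rw [← Nat.card_eq_of_bijective _ (Copy.sigma_iso_bijective G X), Nat.card_sigma]
  simp_rw [h]
  rw [← Finset.sum_filter, Finset.sum_const, smul_eq_mul, numSubgraphs, Set.ncard_eq_toFinset_card']
  congr 2
  ext; simp

instance decidableRelPathGraphAdj (n : ℕ) : DecidableRel (pathGraph n).Adj :=
  fun _ _ ↦ decidable_of_iff _ pathGraph_adj.symm

instance decidableRelSumAdj {X : SimpleGraph V} {Y : SimpleGraph W} [DecidableRel X.Adj]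
    [DecidableRel Y.Adj] : DecidableRel (X ⊕g Y).Adj
  | .inl a, .inl b => inferInstanceAs (Decidable (X.Adj a b))
  | .inr a, .inr b => inferInstanceAs (Decidable (Y.Adj a b))
  | .inl _, .inr _ => .isFalse (by simp)
  | .inr _, .inl _ => .isFalse (by simp)

/-- The pairs `(a, a')`, `(b, b')`, `(c, c')` are the edges of a labelled 3-matching of `G`. -/
def IsLabelledMatching (G : SimpleGraph V) : V × V × V × V × V × V → Prop
  | (a, a', b, b', c, c') =>
    G.Adj a a' ∧ G.Adj b b' ∧ (a ≠ b ∧ a ≠ b' ∧ a' ≠ b ∧ a' ≠ b') ∧ G.Adj c c' ∧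
      (a ≠ c ∧ a ≠ c' ∧ a' ≠ c ∧ a' ≠ c') ∧ b ≠ c ∧ b ≠ c' ∧ b' ≠ c ∧ b' ≠ c'

/-- The vertices `w, a, a'` form a path, and with the edges `(b, b')`, `(c, c')` they form
a labelled copy of `pathGraph 3 ⊕g pathGraph 2 ⊕g pathGraph 2` in `G`. -/
def IsLabelledCherry (G : SimpleGraph V) : V × V × V × V × V × V × V → Prop
  | (w, a, a', b, b', c, c') =>
    IsLabelledMatching G (a, a', b, b', c, c') ∧ G.Adj w a ∧ w ≠ a' ∧ w ≠ b ∧ w ≠ b' ∧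
      w ≠ c ∧ w ≠ c'

/-- The vertices `a', a, b, b'` form a path, and with the edge `(c, c')` they form
a labelled copy of `pathGraph 4 ⊕g pathGraph 2` in `G`. -/
def IsLabelledPath (G : SimpleGraph V) : V × V × V × V × V × V → Prop
  | (a', a, b, b', c, c') => IsLabelledMatching G (a, a', b, b', c, c') ∧ G.Adj a b

theorem IsLabelledMatching.exists_copy {G : SimpleGraph V} {a a' b b' c c' : V}
    (h : IsLabelledMatching G (a, a', b, b', c, c')) :
    ∃ f : Copy (pathGraph 2 ⊕g pathGraph 2 ⊕g pathGraph 2) G,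
      f (.inl (.inl 0)) = a ∧ f (.inl (.inl 1)) = a' ∧
      f (.inl (.inr 0)) = b ∧ f (.inl (.inr 1)) = b' ∧ f (.inr 0) = c ∧ f (.inr 1) = c' := by
  obtain ⟨ha, hb, hab, hc, hac, hbc⟩ := h
  refine ⟨⟨⟨Sum.elim (Sum.elim ![a, a'] ![b, b']) ![c, c'], ?_⟩, ?_⟩, rfl, rfl, rfl, rfl, rfl, rfl⟩
  · simp [Sum.forall, Fin.forall_fin_succ, pathGraph_adj, *, G.adj_comm]
  · refine Function.Injective.sumElim (Function.Injective.sumElim ?_ ?_ ?_) ?_ ?_ <;>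
      simp [Sum.forall, Fin.forall_fin_succ, Function.Injective, *, ha.ne, ha.ne', hb.ne, hb.ne',
        hc.ne, hc.ne']

theorem IsLabelledCherry.exists_copy {G : SimpleGraph V} {w a a' b b' c c' : V}
    (h : IsLabelledCherry G (w, a, a', b, b', c, c')) :
    ∃ f : Copy (pathGraph 3 ⊕g pathGraph 2 ⊕g pathGraph 2) G, f (.inl (.inl 0)) = w ∧
      f (.inl (.inl 1)) = a ∧ f (.inl (.inl 2)) = a' ∧
      f (.inl (.inr 0)) = b ∧ f (.inl (.inr 1)) = b' ∧ f (.inr 0) = c ∧ f (.inr 1) = c' := by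
  obtain ⟨⟨ha, hb, hab, hc, hac, hbc⟩, hw, hwa', hwb, hwb', hwc, hwc'⟩ := h
  refine ⟨⟨⟨Sum.elim (Sum.elim ![w, a, a'] ![b, b']) ![c, c'], ?_⟩, ?_⟩,
    rfl, rfl, rfl, rfl, rfl, rfl, rfl⟩
  · simp [Sum.forall, Fin.forall_fin_succ, pathGraph_adj, *, G.adj_comm]
  · refine Function.Injective.sumElim (Function.Injective.sumElim ?_ ?_ ?_) ?_ ?_ <;>
      simp [Sum.forall, Fin.forall_fin_succ, Function.Injective, *, ha.ne, ha.ne', hb.ne, hb.ne',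
        hc.ne, hc.ne', hw.ne, hw.ne', hwa'.symm]

theorem IsLabelledPath.exists_copy {G : SimpleGraph V} {a' a b b' c c' : V}
    (h : IsLabelledPath G (a', a, b, b', c, c')) :
    ∃ f : Copy (pathGraph 4 ⊕g pathGraph 2) G, f (.inl 0) = a' ∧ f (.inl 1) = a ∧
      f (.inl 2) = b ∧ f (.inl 3) = b' ∧ f (.inr 0) = c ∧ f (.inr 1) = c' := by
  obtain ⟨⟨ha, hb, ⟨hab₁, hab₂, hab₃, hab₄⟩, hc, hac, hbc⟩, h⟩ := h
  refine ⟨⟨⟨Sum.elim ![a', a, b, b'] ![c, c'], ?_⟩, ?_⟩, rfl, rfl, rfl, rfl, rfl, rfl⟩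
  · simp [Sum.forall, Fin.forall_fin_succ, pathGraph_adj, *, ha.symm, hb.symm, hc.symm, h.symm]
  · refine Function.Injective.sumElim ?_ ?_ ?_ <;>
      simp [Fin.forall_fin_succ, Function.Injective, *, ha.ne, ha.ne', hb.ne, hb.ne',
        hc.ne, hc.ne', hab₁.symm, hab₂.symm, hab₃.symm, hab₄.symm]

section

variable (G : SimpleGraph V) [DecidableEq V] [DecidableRel G.Adj]

instance : DecidablePred (IsLabelledMatching G) :=
  fun (_, _, _, _, _, _) ↦ inferInstanceAs (Decidable (_ ∧ _))

instance : DecidablePred (IsLabelledCherry G) :=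
  fun (_, _, _, _, _, _, _) ↦ inferInstanceAs (Decidable (_ ∧ _))

instance : DecidablePred (IsLabelledPath G) :=
  fun (_, _, _, _, _, _) ↦ inferInstanceAs (Decidable (_ ∧ _))

variable [Fintype V]

theorem card_copy_three_edges :
    Nat.card (Copy (pathGraph 2 ⊕g pathGraph 2 ⊕g pathGraph 2) G) =
      ∑ p, if IsLabelledMatching G p then 1 else 0 := by
  rw [← Finset.card_filter, ← Fintype.card_subtype, ← Nat.card_eq_fintype_card]
  refine Nat.card_eq_of_bijective (fun f ↦ ⟨(f (.inl (.inl 0)), f (.inl (.inl 1)),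
    f (.inl (.inr 0)), f (.inl (.inr 1)), f (.inr 0), f (.inr 1)), ?_⟩) ⟨?_, ?_⟩
  · have hadj {x y} (h : (pathGraph 2 ⊕g pathGraph 2 ⊕g pathGraph 2).Adj x y) :
        G.Adj (f x) (f y) := f.toHom.map_adj h
    have hne {x y} (h : x ≠ y) : f x ≠ f y := f.injective.ne h
    refine ⟨hadj (by decide), hadj (by decide), ⟨?_, ?_, ?_, ?_⟩, hadj (by decide),
      ⟨?_, ?_, ?_, ?_⟩, ?_, ?_, ?_, ?_⟩ <;> exact hne (by decide)
  · intro f g h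
    have h := congrArg Subtype.val h
    simp only [Prod.mk.injEq] at h
    ext ((x | x) | x) <;> fin_cases x <;> simp [h]
  · rintro ⟨⟨a, a', b, b', c, c'⟩, h⟩
    obtain ⟨f, rfl, rfl, rfl, rfl, rfl, rfl⟩ := h.exists_copy
    exact ⟨f, rfl⟩

theorem card_copy_cherry :
    Nat.card (Copy (pathGraph 3 ⊕g pathGraph 2 ⊕g pathGraph 2) G) =
      ∑ p, if IsLabelledCherry G p then 1 else 0 := by
  rw [← Finset.card_filter, ← Fintype.card_subtype, ← Nat.card_eq_fintype_card]
  refine Nat.card_eq_of_bijective (fun f ↦ ⟨(f (.inl (.inl 0)), f (.inl (.inl 1)),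
    f (.inl (.inl 2)), f (.inl (.inr 0)), f (.inl (.inr 1)), f (.inr 0), f (.inr 1)), ?_⟩)
    ⟨?_, ?_⟩
  · have hadj {x y} (h : (pathGraph 3 ⊕g pathGraph 2 ⊕g pathGraph 2).Adj x y) :
        G.Adj (f x) (f y) := f.toHom.map_adj h
    have hne {x y} (h : x ≠ y) : f x ≠ f y := f.injective.ne h
    refine ⟨⟨hadj (by decide), hadj (by decide), ⟨?_, ?_, ?_, ?_⟩, hadj (by decide),
      ⟨?_, ?_, ?_, ?_⟩, ?_, ?_, ?_, ?_⟩, hadj (by decide), ?_, ?_, ?_, ?_, ?_⟩ <;>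
        exact hne (by decide)
  · intro f g h
    have h := congrArg Subtype.val h
    simp only [Prod.mk.injEq] at h
    ext ((x | x) | x) <;> fin_cases x <;> simp [h]
  · rintro ⟨⟨w, a, a', b, b', c, c'⟩, h⟩
    obtain ⟨f, rfl, rfl, rfl, rfl, rfl, rfl, rfl⟩ := h.exists_copy
    exact ⟨f, rfl⟩

theorem card_copy_path :
    Nat.card (Copy (pathGraph 4 ⊕g pathGraph 2) G) =
      ∑ p, if IsLabelledPath G p then 1 else 0 := by
  rw [← Finset.card_filter, ← Fintype.card_subtype, ← Nat.card_eq_fintype_card]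
  refine Nat.card_eq_of_bijective (fun f ↦ ⟨(f (.inl 0), f (.inl 1),
    f (.inl 2), f (.inl 3), f (.inr 0), f (.inr 1)), ?_⟩) ⟨?_, ?_⟩
  · have hadj {x y} (h : (pathGraph 4 ⊕g pathGraph 2).Adj x y) :
        G.Adj (f x) (f y) := f.toHom.map_adj h
    have hne {x y} (h : x ≠ y) : f x ≠ f y := f.injective.ne h
    refine ⟨⟨hadj (by decide), hadj (by decide), ⟨?_, ?_, ?_, ?_⟩, hadj (by decide),
      ⟨?_, ?_, ?_, ?_⟩, ?_, ?_, ?_, ?_⟩, hadj (by decide)⟩ <;> exact hne (by decide)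
  · intro f g h
    have h := congrArg Subtype.val h
    simp only [Prod.mk.injEq] at h
    ext (x | x) <;> fin_cases x <;> simp [h]
  · rintro ⟨⟨a', a, b, b', c, c'⟩, h⟩
    obtain ⟨f, rfl, rfl, rfl, rfl, rfl, rfl⟩ := h.exists_copy
    exact ⟨f, rfl⟩

end

section
variable (G : SimpleGraph V) [DecidableEq V] [DecidableRel G.Adj] [Fintype V]

theorem sum_isLabelledMatching :
    (∑ p, if IsLabelledMatching G p then 1 else 0) =
      ∑ a, ∑ a', if G.Adj a a' then ∑ b, ∑ b', if G.Adj b b' then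
      if a ≠ b ∧ a ≠ b' ∧ a' ≠ b ∧ a' ≠ b' then ∑ c, ∑ c', if G.Adj c c' then
      if (a ≠ c ∧ a ≠ c' ∧ a' ≠ c ∧ a' ≠ c') ∧ b ≠ c ∧ b ≠ c' ∧ b' ≠ c ∧ b' ≠ c'
      then 1 else 0 else 0 else 0 else 0 else 0 := by
  have key (a a' b b' c c') : (if IsLabelledMatching G (a, a', b, b', c, c') then 1 else 0) =
      if G.Adj a a' then if G.Adj b b' then
      if a ≠ b ∧ a ≠ b' ∧ a' ≠ b ∧ a' ≠ b' then if G.Adj c c' then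
      if (a ≠ c ∧ a ≠ c' ∧ a' ≠ c ∧ a' ≠ c') ∧ b ≠ c ∧ b ≠ c' ∧ b' ≠ c ∧ b' ≠ c'
      then 1 else 0 else 0 else 0 else 0 else 0 := by
    simp only [IsLabelledMatching, ← ite_and]
    congr
  simp only [Fintype.sum_prod_type, key, Finset.sum_ite_irrel, Finset.sum_const_zero]

theorem sum_isLabelledCherry :
    (∑ p, if IsLabelledCherry G p then 1 else 0) =
      ∑ w, ∑ a, if G.Adj w a then ∑ a', if G.Adj a a' ∧ w ≠ a' then
      ∑ b, ∑ b', if G.Adj b b' then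
      if w ≠ b ∧ w ≠ b' ∧ a ≠ b ∧ a ≠ b' ∧ a' ≠ b ∧ a' ≠ b' then ∑ c, ∑ c', if G.Adj c c' then
      if w ≠ c ∧ w ≠ c' ∧ (a ≠ c ∧ a ≠ c' ∧ a' ≠ c ∧ a' ≠ c') ∧ b ≠ c ∧ b ≠ c' ∧ b' ≠ c ∧ b' ≠ c'
      then 1 else 0 else 0 else 0 else 0 else 0 else 0 := by
  have key (w a a' b b' c c') : (if IsLabelledCherry G (w, a, a', b, b', c, c') then 1 else 0) =
      if G.Adj w a then if G.Adj a a' ∧ w ≠ a' then if G.Adj b b' then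
      if w ≠ b ∧ w ≠ b' ∧ a ≠ b ∧ a ≠ b' ∧ a' ≠ b ∧ a' ≠ b' then if G.Adj c c' then
      if w ≠ c ∧ w ≠ c' ∧ (a ≠ c ∧ a ≠ c' ∧ a' ≠ c ∧ a' ≠ c') ∧ b ≠ c ∧ b ≠ c' ∧ b' ≠ c ∧ b' ≠ c'
      then 1 else 0 else 0 else 0 else 0 else 0 else 0 := by
    simp only [IsLabelledCherry, IsLabelledMatching, ← ite_and]
    congr 1
    exact propext (by tauto)
  simp only [Fintype.sum_prod_type, key, Finset.sum_ite_irrel, Finset.sum_const_zero]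

theorem sum_isLabelledPath :
    (∑ p, if IsLabelledPath G p then 1 else 0) =
      ∑ a', ∑ a, if G.Adj a a' then ∑ b, if G.Adj a b then ∑ b', if G.Adj b b' then
      if a ≠ b ∧ a ≠ b' ∧ a' ≠ b ∧ a' ≠ b' then ∑ c, ∑ c', if G.Adj c c' then
      if (a ≠ c ∧ a ≠ c' ∧ a' ≠ c ∧ a' ≠ c') ∧ b ≠ c ∧ b ≠ c' ∧ b' ≠ c ∧ b' ≠ c'
      then 1 else 0 else 0 else 0 else 0 else 0 else 0 := by
  have key (a a' b b' c c') : (if IsLabelledPath G (a', a, b, b', c, c') then 1 else 0) =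
      if G.Adj a a' then if G.Adj a b then if G.Adj b b' then
      if a ≠ b ∧ a ≠ b' ∧ a' ≠ b ∧ a' ≠ b' then if G.Adj c c' then
      if (a ≠ c ∧ a ≠ c' ∧ a' ≠ c ∧ a' ≠ c') ∧ b ≠ c ∧ b ≠ c' ∧ b' ≠ c ∧ b' ≠ c'
      then 1 else 0 else 0 else 0 else 0 else 0 else 0 := by
    simp only [IsLabelledPath, IsLabelledMatching, ← ite_and]
    congr 1
    exact propext (by tauto)
  simp only [Fintype.sum_prod_type, key, Finset.sum_ite_irrel, Finset.sum_const_zero]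

end

theorem card_copy_three_edges_self :
    Nat.card (Copy (pathGraph 2 ⊕g pathGraph 2 ⊕g pathGraph 2)
      (pathGraph 2 ⊕g pathGraph 2 ⊕g pathGraph 2)) = 48 := by
  rw [card_copy_three_edges, sum_isLabelledMatching]
  decide +kernel

theorem card_copy_path_self :
    Nat.card (Copy (pathGraph 4 ⊕g pathGraph 2) (pathGraph 4 ⊕g pathGraph 2)) = 4 := by
  rw [card_copy_path, sum_isLabelledPath]
  decide +kernel

theorem card_copy_cherry_self :
    Nat.card (Copy (pathGraph 3 ⊕g pathGraph 2 ⊕g pathGraph 2)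
      (pathGraph 3 ⊕g pathGraph 2 ⊕g pathGraph 2)) = 16 := by
  rw [card_copy_cherry, sum_isLabelledCherry]
  decide +kernel

theorem Subgraph.isMatching_and_ncard_edgeSet_eq_three_iff {G : SimpleGraph V}
    (H : G.Subgraph) : (H.IsMatching ∧ H.edgeSet.ncard = 3) ↔
      Nonempty (H.coe ≃g (pathGraph 2 ⊕g pathGraph 2 ⊕g pathGraph 2)) := by
  constructor
  · rintro ⟨hM, hE⟩
    obtain ⟨x, y, z, hxy, hxz, hyz, hE⟩ := Set.ncard_eq_three.1 hE
    induction x with | _ a a'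
    induction y with | _ b b'
    induction z with | _ c c'
    have hadj (u v : V) : H.Adj u v ↔ s(u, v) = s(a, a') ∨ s(u, v) = s(b, b') ∨
        s(u, v) = s(c, c') := by
      rw [← Subgraph.mem_edgeSet, hE]; simp
    have ha : H.Adj a a' := (hadj _ _).2 (.inl rfl)
    have hb : H.Adj b b' := (hadj _ _).2 (.inr (.inl rfl))
    have hc : H.Adj c c' := (hadj _ _).2 (.inr (.inr rfl))
    have disj {u u' v v' : V} (hu : H.Adj u u') (hv : H.Adj v v') (h : s(u, u') ≠ s(v, v')) :
        u ≠ v ∧ u ≠ v' ∧ u' ≠ v ∧ u' ≠ v' := by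
      refine ⟨?_, ?_, ?_, ?_⟩ <;> rintro rfl <;> apply h
      · rw [hM.eq_of_adj_left hu hv]
      · rw [hM.eq_of_adj_left hu hv.symm, Sym2.eq_swap]
      · rw [hM.eq_of_adj_left hu.symm hv, Sym2.eq_swap]
      · rw [hM.eq_of_adj_left hu.symm hv.symm]
    have hab := disj ha hb hxy
    have hac := disj ha hc hxz
    have hbc := disj hb hc hyz
    obtain ⟨f, rfl, rfl, rfl, rfl, rfl, rfl⟩ := IsLabelledMatching.exists_copy
      ⟨ha.adj_sub, hb.adj_sub, hab, hc.adj_sub, hac, hbc⟩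
    have hadj' {u v} (huv : (pathGraph 2 ⊕g pathGraph 2 ⊕g pathGraph 2).Adj u v) :
        H.Adj (f u) (f v) := by
      rcases u with (u | u) | u <;> rcases v with (v | v) | v <;> fin_cases u <;> fin_cases v <;>
        first
        | assumption
        | exact Subgraph.Adj.symm (by assumption)
        | exact absurd huv (by decide)
    have hf {u v} : H.Adj (f u) (f v) ↔
        (pathGraph 2 ⊕g pathGraph 2 ⊕g pathGraph 2).Adj u v := by
      refine ⟨fun h ↦ ?_, hadj'⟩
      have key : ∀ u, ∃ w, (pathGraph 2 ⊕g pathGraph 2 ⊕g pathGraph 2).Adj u w := by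
        decide +kernel
      obtain ⟨w, hw⟩ := key u
      rwa [f.injective (hM.eq_of_adj_left h (hadj' hw))]
    have hmem (u) : f u ∈ H.verts := by
      rcases u with (u | u) | u <;> fin_cases u
      exacts [ha.fst_mem, ha.snd_mem, hb.fst_mem, hb.snd_mem, hc.fst_mem, hc.snd_mem]
    have hbij : Function.Bijective (fun u ↦ (⟨f u, hmem u⟩ : H.verts)) := by
      constructor
      · exact fun u v h ↦ f.injective (congrArg Subtype.val h)
      · rintro ⟨v, hv⟩
        obtain ⟨w, hw, -⟩ := hM hv
        rcases (hadj v w).1 hw with h | h | h <;>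
          rcases Sym2.eq_iff.1 h with ⟨rfl, -⟩ | ⟨rfl, -⟩
        exacts [⟨.inl (.inl 0), rfl⟩, ⟨.inl (.inl 1), rfl⟩, ⟨.inl (.inr 0), rfl⟩,
          ⟨.inl (.inr 1), rfl⟩, ⟨.inr 0, rfl⟩, ⟨.inr 1, rfl⟩]
    exact ⟨Iso.symm ⟨Equiv.ofBijective _ hbij, hf⟩⟩
  · rintro ⟨e⟩
    constructor
    · intro v hv
      have key : ∀ u, ∃ w, (pathGraph 2 ⊕g pathGraph 2 ⊕g pathGraph 2).Adj u w ∧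
          ∀ w', (pathGraph 2 ⊕g pathGraph 2 ⊕g pathGraph 2).Adj u w' → w' = w := by
        decide +kernel
      obtain ⟨w, hw, huniq⟩ := key (e ⟨v, hv⟩)
      refine ⟨e.symm w, ?_, fun w' hw' ↦ ?_⟩
      · have := e.symm.map_adj_iff.2 hw
        rwa [e.symm_apply_apply] at this
      · have := huniq (e ⟨w', hw'.snd_mem⟩) (e.map_adj_iff.2 hw')
        rw [← this, e.symm_apply_apply]
    · rw [← image_coe_edgeSet_coe,
        Set.ncard_image_of_injective _ (Sym2.map.injective Subtype.val_injective),
        ← Nat.card_coe_set_eq, Nat.card_congr e.mapEdgeSet, Nat.card_eq_fintype_card]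
      decide +kernel

theorem numMatchings_three (G : SimpleGraph V) :
    numMatchings G 3 = numSubgraphs G (pathGraph 2 ⊕g pathGraph 2 ⊕g pathGraph 2) := by
  simp only [numMatchings, numSubgraphs, Subgraph.isMatching_and_ncard_edgeSet_eq_three_iff]

variable (G : SimpleGraph V) [DecidableEq V] [DecidableRel G.Adj] [Fintype V]

theorem IsRegularOfDegree.two_mul_isLabelledMatching (hreg : G.IsRegularOfDegree 3)
    (a a' b b' c c' : V) :
    (2 * if IsLabelledMatching G (a, a', b, b', c, c') then 1 else 0) =
      (∑ w, if IsLabelledCherry G (w, a, a', b, b', c, c') then 1 else 0) +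
      ((if IsLabelledPath G (a', a, b, b', c, c') then 1 else 0) +
      (if IsLabelledPath G (a', a, b', b, c, c') then 1 else 0) +
      (if IsLabelledPath G (a', a, c, c', b, b') then 1 else 0) +
      (if IsLabelledPath G (a', a, c', c, b, b') then 1 else 0)) := by
  by_cases h : IsLabelledMatching G (a, a', b, b', c, c')
  · have hdeg := hreg a
    rw [← card_neighborFinset_eq_degree, neighborFinset_eq_filter, Finset.card_filter] at hdeg
    have hsplit (w : V) : (if G.Adj a w then 1 else 0) =
        (if IsLabelledCherry G (w, a, a', b, b', c, c') then 1 else 0) +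
        ((if w = a' then 1 else 0) + (if w = b then if G.Adj a b then 1 else 0 else 0) +
        (if w = b' then if G.Adj a b' then 1 else 0 else 0) +
        (if w = c then if G.Adj a c then 1 else 0 else 0) +
        (if w = c' then if G.Adj a c' then 1 else 0 else 0)) := by
      simp only [IsLabelledCherry, h, true_and]
      simp only [IsLabelledMatching] at h
      grind [G.adj_comm, G.ne_of_adj]
    rw [Finset.sum_congr rfl fun w _ ↦ hsplit w] at hdeg
    simp only [Finset.sum_add_distrib, Finset.sum_ite_eq', Finset.mem_univ, if_true] at hdeg
    have h1 : IsLabelledMatching G (a, a', b', b, c, c') := by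
      simp only [IsLabelledMatching] at h ⊢; grind [G.adj_comm]
    have h2 : IsLabelledMatching G (a, a', c, c', b, b') := by
      simp only [IsLabelledMatching] at h ⊢; grind [G.adj_comm]
    have h3 : IsLabelledMatching G (a, a', c', c, b, b') := by
      simp only [IsLabelledMatching] at h ⊢; grind [G.adj_comm]
    simp only [IsLabelledPath, h, h1, h2, h3, true_and, if_true]
    lia
  · have h1 : ¬ IsLabelledMatching G (a, a', b', b, c, c') := by
      simp only [IsLabelledMatching] at h ⊢; grind [G.adj_comm]
    have h2 : ¬ IsLabelledMatching G (a, a', c, c', b, b') := by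
      simp only [IsLabelledMatching] at h ⊢; grind [G.adj_comm]
    have h3 : ¬ IsLabelledMatching G (a, a', c', c, b, b') := by
      simp only [IsLabelledMatching] at h ⊢; grind [G.adj_comm]
    simp [IsLabelledPath, IsLabelledCherry, h, h1, h2, h3]

theorem IsRegularOfDegree.two_mul_card_copy (hreg : G.IsRegularOfDegree 3) :
    2 * Nat.card (Copy (pathGraph 2 ⊕g pathGraph 2 ⊕g pathGraph 2) G) =
      Nat.card (Copy (pathGraph 3 ⊕g pathGraph 2 ⊕g pathGraph 2) G) +
      4 * Nat.card (Copy (pathGraph 4 ⊕g pathGraph 2) G) := by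
  let F : V × V × V × V × V × V → ℕ := fun p ↦ if IsLabelledPath G p then 1 else 0
  have hsum : ∑ p, (if IsLabelledMatching G p then 1 else 0) * 2 =
      ∑ p, ((∑ w, if IsLabelledCherry G (w, p) then 1 else 0) +
        (F (p.2.1, p.1, p.2.2.1, p.2.2.2.1, p.2.2.2.2.1, p.2.2.2.2.2) +
        F (p.2.1, p.1, p.2.2.2.1, p.2.2.1, p.2.2.2.2.1, p.2.2.2.2.2) +
        F (p.2.1, p.1, p.2.2.2.2.1, p.2.2.2.2.2, p.2.2.1, p.2.2.2.1) +
        F (p.2.1, p.1, p.2.2.2.2.2, p.2.2.2.2.1, p.2.2.1, p.2.2.2.1))) := by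
    refine Finset.sum_congr rfl fun ⟨a, a', b, b', c, c'⟩ _ ↦ ?_
    rw [mul_comm]
    exact two_mul_isLabelledMatching G hreg a a' b b' c c'
  have e1 : ∑ p : V × V × V × V × V × V,
      F (p.2.1, p.1, p.2.2.1, p.2.2.2.1, p.2.2.2.2.1, p.2.2.2.2.2) = ∑ p, F p :=
    Fintype.sum_equiv ⟨fun (a, a', b, b', c, c') ↦ (a', a, b, b', c, c'),
      fun (a, a', b, b', c, c') ↦ (a', a, b, b', c, c'), fun _ ↦ rfl, fun _ ↦ rfl⟩ _ _ fun _ ↦ rfl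
  have e2 : ∑ p : V × V × V × V × V × V,
      F (p.2.1, p.1, p.2.2.2.1, p.2.2.1, p.2.2.2.2.1, p.2.2.2.2.2) = ∑ p, F p :=
    Fintype.sum_equiv ⟨fun (a, a', b, b', c, c') ↦ (a', a, b', b, c, c'),
      fun (a, a', b, b', c, c') ↦ (a', a, b', b, c, c'), fun _ ↦ rfl, fun _ ↦ rfl⟩ _ _ fun _ ↦ rfl
  have e3 : ∑ p : V × V × V × V × V × V,
      F (p.2.1, p.1, p.2.2.2.2.1, p.2.2.2.2.2, p.2.2.1, p.2.2.2.1) = ∑ p, F p :=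
    Fintype.sum_equiv ⟨fun (a, a', b, b', c, c') ↦ (a', a, c, c', b, b'),
      fun (a, a', b, b', c, c') ↦ (a', a, c, c', b, b'), fun _ ↦ rfl, fun _ ↦ rfl⟩ _ _ fun _ ↦ rfl
  have e4 : ∑ p : V × V × V × V × V × V,
      F (p.2.1, p.1, p.2.2.2.2.2, p.2.2.2.2.1, p.2.2.1, p.2.2.2.1) = ∑ p, F p :=
    Fintype.sum_equiv ⟨fun (a, a', b, b', c, c') ↦ (a', a, c', c, b, b'),
      fun (a, a', b, b', c, c') ↦ (a', a, c, c', b', b), fun _ ↦ rfl, fun _ ↦ rfl⟩ _ _ fun _ ↦ rfl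
  rw [card_copy_cherry, Fintype.sum_prod_type_right, card_copy_three_edges, card_copy_path,
    mul_comm 2, Finset.sum_mul, hsum]
  simp only [Finset.sum_add_distrib, e1, e2, e3, e4]
  simp only [F]
  ring

end SimpleGraph

theorem stmt_8 {V : Type*} [Fintype V] [DecidableEq V] (G : SimpleGraph V) [DecidableRel G.Adj]
    (hreg : G.IsRegularOfDegree 3) (hbip : G.Colorable 2) :
    12 * numMatchings G 3 = 2 * numSubgraphs G (pathGraph 3 ⊕g pathGraph 2 ⊕g pathGraph 2) + 2 * numSubgraphs G (pathGraph 4 ⊕g pathGraph 2) := by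
  have h := hreg.two_mul_card_copy
  rw [card_copy_eq_numSubgraphs_mul, card_copy_eq_numSubgraphs_mul G (pathGraph 3 ⊕g _ ⊕g _),
    card_copy_eq_numSubgraphs_mul G (pathGraph 4 ⊕g _), card_copy_three_edges_self,
    card_copy_cherry_self, card_copy_path_self, ← numMatchings_three] at h
  lia
end

section
/- Let G be a finite simple 3-regular bipartite graph on exactly 2h+8 vertices (h a natural number) having exactly six cycles of length 4, any two distinct 4-cycles of G sharing at most one edge. Then N(C₄+2K₂) = 27h² + 27h + 12. -/
open SimpleGraph

namespace SimpleGraph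

variable {V : Type*}

/-- The edge sets of the `2`-matchings of a finite graph. -/
noncomputable def twoMatchings [Fintype V] (G : SimpleGraph V) : Finset (Finset (Sym2 V)) := by
  classical
  exact (G.edgeFinset.powersetCard 2).filter fun s => ∀ v, ∀ e ∈ s, ∀ f ∈ s, v ∈ e → v ∈ f → e = f

lemma mem_twoMatchings [Fintype V] {G : SimpleGraph V} {s : Finset (Sym2 V)} :
    s ∈ G.twoMatchings ↔ ((∀ e ∈ s, e ∈ G.edgeSet) ∧ s.card = 2) ∧
      ∀ v, ∀ e ∈ s, ∀ f ∈ s, v ∈ e → v ∈ f → e = f := by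
  classical
  simp [twoMatchings, Finset.mem_powersetCard, Finset.subset_iff]

/-- A pair of edges either is a matching or consists of two edges at a unique vertex. -/
lemma card_twoMatchings_add_sum_choose_degree [Fintype V] (G : SimpleGraph V)
    [DecidableRel G.Adj] :
    G.twoMatchings.card + ∑ v, (G.degree v).choose 2 = G.edgeFinset.card.choose 2 := by
  classical
  have hstar : (G.edgeFinset.powersetCard 2).filter
      (fun s => ¬ ∀ v, ∀ e ∈ s, ∀ f ∈ s, v ∈ e → v ∈ f → e = f) =
      Finset.univ.biUnion fun v => (G.incidenceFinset v).powersetCard 2 := by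
    ext s
    simp only [Finset.mem_filter, Finset.mem_powersetCard, Finset.mem_biUnion, Finset.mem_univ,
      true_and, Finset.subset_iff, mem_edgeFinset, mem_incidenceFinset]
    constructor
    · rintro ⟨⟨hE, h2⟩, hs⟩
      push Not at hs
      obtain ⟨v, e, he, f, hf, hve, hvf, hne⟩ := hs
      have : s = {e, f} := (Finset.eq_of_subset_of_card_le
        (by simp [Finset.insert_subset_iff, he, hf])
        (by rw [h2, Finset.card_pair hne])).symm
      refine ⟨v, fun x hx => ⟨hE hx, ?_⟩, h2⟩
      rw [this] at hx
      simp only [Finset.mem_insert, Finset.mem_singleton] at hx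
      rcases hx with rfl | rfl <;> assumption
    · rintro ⟨v, hs, h2⟩
      refine ⟨⟨fun x hx => (hs hx).1, h2⟩, fun hm => ?_⟩
      obtain ⟨e, f, hne, rfl⟩ := Finset.card_eq_two.1 h2
      exact hne (hm v e (by simp) f (by simp) (hs (by simp)).2 (hs (by simp)).2)
  have hdisj : ((Finset.univ : Finset V) : Set V).PairwiseDisjoint
      fun v => (G.incidenceFinset v).powersetCard 2 := by
    intro u _ v _ huv
    refine Finset.disjoint_left.2 fun s hu hv => ?_
    simp only [Finset.mem_powersetCard, Finset.subset_iff, mem_incidenceFinset] at hu hv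
    obtain ⟨e, f, hne, rfl⟩ := Finset.card_eq_two.1 hu.2
    refine hne ?_
    have heq : ∀ x ∈ ({e, f} : Finset (Sym2 V)), x = s(u, v) := fun x hx =>
      (Sym2.mem_and_mem_iff huv).1 ⟨(hu.1 hx).2, (hv.1 hx).2⟩
    rw [heq e (by simp), heq f (by simp)]
  have h := Finset.card_filter_add_card_filter_not (s := G.edgeFinset.powersetCard 2)
    (fun s => ∀ v, ∀ e ∈ s, ∀ f ∈ s, v ∈ e → v ∈ f → e = f)
  rw [hstar, Finset.card_biUnion hdisj, Finset.card_powersetCard] at h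
  simp only [Finset.card_powersetCard, card_incidenceFinset_eq_degree] at h
  rw [← h, twoMatchings]
  congr!

/-- The graph `G` with all edges meeting `S` removed. -/
def awayFrom (G : SimpleGraph V) (S : Set V) : SimpleGraph V where
  Adj u v := G.Adj u v ∧ u ∉ S ∧ v ∉ S
  symm := ⟨fun _ _ h => ⟨h.1.symm, h.2.2, h.2.1⟩⟩
  loopless := ⟨fun _ h => h.1.ne rfl⟩

lemma awayFrom_adj {G : SimpleGraph V} {S : Set V} {u v : V} :
    (G.awayFrom S).Adj u v ↔ G.Adj u v ∧ u ∉ S ∧ v ∉ S := Iff.rfl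

lemma card_twoMatchings_awayFrom [Fintype V] [DecidableEq V] (G : SimpleGraph V)
    [DecidableRel G.Adj] (hreg : G.IsRegularOfDegree 3) (h : ℕ)
    (hcard : Fintype.card V = 2 * h + 8) (C : Finset V) (hC : C.card = 4)
    (hin : ∀ x ∈ C, (G.neighborFinset x ∩ C).card = 2)
    (hout : ∀ v ∉ C, (G.neighborFinset v ∩ C).card ≤ 1) :
    2 * (G.awayFrom C).twoMatchings.card = 9 * h ^ 2 + 9 * h + 4 := by
  classical
  set N := C.biUnion fun x => G.neighborFinset x \ C with hN
  have hNcard : N.card = 4 := by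
    rw [hN, Finset.card_biUnion]
    · rw [Finset.sum_congr rfl (g := fun _ => 1), Finset.sum_const, hC, smul_eq_mul]
      intro x hx
      have h1 := Finset.card_sdiff_add_card_inter (G.neighborFinset x) C
      rw [hin x hx, card_neighborFinset_eq_degree, hreg x] at h1
      lia
    · intro x hx y hy hxy
      refine Finset.disjoint_left.2 fun v hvx hvy => hxy ?_
      simp only [Finset.mem_sdiff, mem_neighborFinset] at hvx hvy
      exact Finset.card_le_one.1 (hout v hvx.2) x (by simpa [hvx.1.symm] using hx) y
        (by simpa [hvy.1.symm] using hy)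
  have hNC : Disjoint C N := by
    rw [Finset.disjoint_left]
    intro x hx hxN
    simp only [hN, Finset.mem_biUnion, Finset.mem_sdiff] at hxN
    obtain ⟨_, _, _, h⟩ := hxN
    exact h hx
  have hdegC : ∀ v ∈ C, (G.awayFrom C).degree v = 0 := by
    intro v hv
    rw [← card_neighborFinset_eq_degree, Finset.card_eq_zero, Finset.eq_empty_iff_forall_notMem]
    intro x hx
    rw [mem_neighborFinset] at hx
    exact hx.2.1 hv
  have hdeg : ∀ v ∉ C, (G.awayFrom C).degree v + (G.neighborFinset v ∩ C).card = 3 := by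
    intro v hv
    have : (G.awayFrom C).neighborFinset v = G.neighborFinset v \ C := by
      ext x
      simp [awayFrom_adj, hv]
    rw [← card_neighborFinset_eq_degree, this, Finset.card_sdiff_add_card_inter,
      card_neighborFinset_eq_degree, hreg v]
  have hdegN : ∀ v ∈ N, (G.awayFrom C).degree v = 2 := by
    intro v hv
    have hvC := Finset.disjoint_right.1 hNC hv
    simp only [hN, Finset.mem_biUnion, Finset.mem_sdiff, mem_neighborFinset] at hv
    obtain ⟨x, hx, hxv, -⟩ := hv
    have h1 : 0 < (G.neighborFinset v ∩ C).card :=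
      Finset.card_pos.2 ⟨x, by simp [hx, hxv.symm]⟩
    have := hdeg v hvC
    have := hout v hvC
    lia
  have hdegR : ∀ v ∈ (C ∪ N)ᶜ, (G.awayFrom C).degree v = 3 := by
    intro v hv
    simp only [Finset.mem_compl, Finset.mem_union, not_or] at hv
    have h1 : (G.neighborFinset v ∩ C).card = 0 := by
      rw [Finset.card_eq_zero, Finset.eq_empty_iff_forall_notMem]
      intro x hx
      simp only [Finset.mem_inter, mem_neighborFinset] at hx
      refine hv.2 ?_
      simp only [hN, Finset.mem_biUnion, Finset.mem_sdiff, mem_neighborFinset]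
      exact ⟨x, hx.2, hx.1.symm, hv.1⟩
    have := hdeg v hv.1
    lia
  have hR : ((C ∪ N)ᶜ).card = 2 * h := by
    rw [Finset.card_compl, Finset.card_union_of_disjoint hNC, hC, hNcard, hcard]
    lia
  have hsum : ∀ g : ℕ → ℕ, ∑ v, g ((G.awayFrom C).degree v) = 4 * g 0 + 4 * g 2 + 2 * h * g 3 := by
    intro g
    rw [← Finset.sum_add_sum_compl (C ∪ N), Finset.sum_union hNC,
      Finset.sum_congr rfl fun v hv => congrArg g (hdegC v hv),
      Finset.sum_congr rfl fun v hv => congrArg g (hdegN v hv),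
      Finset.sum_congr rfl fun v hv => congrArg g (hdegR v hv)]
    simp only [Finset.sum_const, hC, hNcard, hR, smul_eq_mul]
  have hedges : (G.awayFrom C).edgeFinset.card = 3 * h + 4 := by
    have h1 := (G.awayFrom C).sum_degrees_eq_twice_card_edges
    have h2 := hsum id
    simp only [id] at h2
    lia
  have hmain := (G.awayFrom C).card_twoMatchings_add_sum_choose_degree
  rw [hedges, hsum fun d => d.choose 2] at hmain
  have hch : 2 * (3 * h + 4).choose 2 = (3 * h + 4) * (3 * h + 3) := by
    rw [Nat.choose_two_right, Nat.mul_div_cancel' (Nat.even_mul_pred_self _).two_dvd]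
    rfl
  rw [show Nat.choose 0 2 = 0 from rfl, show Nat.choose 2 2 = 1 from rfl,
    show Nat.choose 3 2 = 3 from rfl] at hmain
  nlinarith

namespace Subgraph

variable {G : SimpleGraph V}

/-- The subgraph obtained from `C` by adding the edges of `G` that lie in `s`. -/
def addEdges (C : G.Subgraph) (s : Finset (Sym2 V)) : G.Subgraph where
  verts := C.verts ∪ {v | ∃ w, G.Adj v w ∧ s(v, w) ∈ s}
  Adj u v := C.Adj u v ∨ G.Adj u v ∧ s(u, v) ∈ s
  adj_sub h := h.elim C.adj_sub And.left
  edge_vert h := h.imp C.edge_vert fun h => ⟨_, h⟩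
  symm := ⟨fun _ _ h => h.imp Subgraph.Adj.symm fun h => ⟨h.1.symm, Sym2.eq_swap ▸ h.2⟩⟩

lemma addEdges_adj {C : G.Subgraph} {s : Finset (Sym2 V)} {u v : V} :
    (C.addEdges s).Adj u v ↔ C.Adj u v ∨ G.Adj u v ∧ s(u, v) ∈ s := Iff.rfl

lemma mem_verts_addEdges {C : G.Subgraph} {s : Finset (Sym2 V)} {v : V} :
    v ∈ (C.addEdges s).verts ↔ v ∈ C.verts ∨ ∃ w, G.Adj v w ∧ s(v, w) ∈ s := Iff.rfl

section Recover

variable [Fintype V] {C : G.Subgraph} {s : Finset (Sym2 V)}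

lemma mem_twoMatchings_awayFrom_iff_addEdges_adj (hs : s ∈ (G.awayFrom C.verts).twoMatchings)
    {u v : V} : s(u, v) ∈ s ↔ (C.addEdges s).Adj u v ∧ ¬ C.Adj u v := by
  rw [mem_twoMatchings] at hs
  rw [addEdges_adj]
  refine ⟨fun h => ?_, by tauto⟩
  have := hs.1.1 _ h
  rw [mem_edgeSet, awayFrom_adj] at this
  exact ⟨Or.inr ⟨this.1, h⟩, fun h => this.2.1 (C.edge_vert h)⟩

lemma adj_iff_addEdges_adj (hs : s ∈ (G.awayFrom C.verts).twoMatchings)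
    (hC : ∀ u v, C.Adj u v → ∃ w, w ≠ v ∧ C.Adj u w) {u v : V} :
    C.Adj u v ↔ (C.addEdges s).Adj u v ∧ ∃ w, w ≠ v ∧ (C.addEdges s).Adj u w := by
  constructor
  · intro h
    obtain ⟨w, hw, hadj⟩ := hC u v h
    exact ⟨Or.inl h, w, hw, Or.inl hadj⟩
  · rintro ⟨h, w, hw, hadj⟩
    by_contra hn
    have hv := (mem_twoMatchings_awayFrom_iff_addEdges_adj hs).2 ⟨h, hn⟩
    have hu : u ∉ C.verts := ((mem_twoMatchings.1 hs).1.1 _ hv).2.1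
    have hw' := (mem_twoMatchings_awayFrom_iff_addEdges_adj hs).2
      ⟨hadj, fun h => hu (C.edge_vert h)⟩
    have := (mem_twoMatchings.1 hs).2 u _ hw' _ hv (Sym2.mem_mk_left _ _) (Sym2.mem_mk_left _ _)
    exact hw (Sym2.congr_right.1 this)

end Recover

end Subgraph

variable {G : SimpleGraph V} {W : Type*} {X : SimpleGraph W}

lemma nonempty_coe_iso_iff_exists_copy {H : G.Subgraph} :
    Nonempty (H.coe ≃g X) ↔ ∃ f : Copy X G, f.toSubgraph = H := by
  have h := Set.ext_iff.1 (Copy.range_toSubgraph (A := X) (B := G)) H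
  rw [Set.mem_range, Set.mem_ofPred_eq] at h
  rw [h]
  exact ⟨fun ⟨e⟩ => ⟨e.symm⟩, fun ⟨e⟩ => ⟨e.symm⟩⟩

lemma Copy.toSubgraph_adj (f : Copy X G) {u v : V} :
    f.toSubgraph.Adj u v ↔ ∃ i j, X.Adj i j ∧ f i = u ∧ f j = v := Iff.rfl

lemma Copy.mem_verts_toSubgraph (f : Copy X G) {v : V} :
    v ∈ f.toSubgraph.verts ↔ ∃ i, f i = v := by
  change v ∈ f.toHom '' Set.univ ↔ _
  simp

section FourCycle

variable (c : Copy (cycleGraph 4) G)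

lemma Copy.exists_ne_adj_of_cycleGraph_four (u v : V) (h : c.toSubgraph.Adj u v) :
    ∃ w, w ≠ v ∧ c.toSubgraph.Adj u w := by
  obtain ⟨i, j, hij, rfl, rfl⟩ := h
  have : ∀ i j : Fin 4, (cycleGraph 4).Adj i j → ∃ k, k ≠ j ∧ (cycleGraph 4).Adj i k := by decide
  obtain ⟨k, hk, hik⟩ := this i j hij
  exact ⟨c k, fun h => hk (c.injective h), i, k, hik, rfl, rfl⟩

lemma Copy.exists_adj_of_mem_verts_cycleGraph_four (u : V) :
    u ∈ c.toSubgraph.verts ↔ ∃ v, c.toSubgraph.Adj u v := by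
  refine ⟨fun h => ?_, fun ⟨v, h⟩ => c.toSubgraph.edge_vert h⟩
  obtain ⟨i, rfl⟩ := c.mem_verts_toSubgraph.1 h
  have : ∀ i : Fin 4, ∃ k, (cycleGraph 4).Adj i k := by decide
  obtain ⟨k, hik⟩ := this i
  exact ⟨c k, i, k, hik, rfl, rfl⟩

/-- In a bipartite graph a `4`-cycle has no chords. -/
lemma Copy.adj_iff_of_cycleGraph_four (hbip : G.Colorable 2) {i j : Fin 4} :
    G.Adj (c i) (c j) ↔ (cycleGraph 4).Adj i j := by
  refine ⟨fun h => ?_, fun h => c.toHom.map_adj h⟩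
  obtain ⟨col⟩ := hbip
  have key : ∀ k : Fin 4 → Fin 2, (∀ i j, (cycleGraph 4).Adj i j → k i ≠ k j) →
      ∀ i j, k i ≠ k j → (cycleGraph 4).Adj i j := by decide
  exact key (fun i => col (c i)) (fun i j hij => col.valid (c.toHom.map_adj hij)) i j (col.valid h)

lemma card_twoMatchings_awayFrom_cycleGraph_four [Fintype V] [DecidableEq V]
    [DecidableRel G.Adj] (hreg : G.IsRegularOfDegree 3) (hbip : G.Colorable 2) (h : ℕ)
    (hcard : Fintype.card V = 2 * h + 8)
    (hshare : ∀ H₁ H₂ : G.Subgraph, Nonempty (H₁.coe ≃g cycleGraph 4) →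
      Nonempty (H₂.coe ≃g cycleGraph 4) → H₁ ≠ H₂ →
      (H₁.edgeSet ∩ H₂.edgeSet).ncard ≤ 1) :
    2 * (G.awayFrom c.toSubgraph.verts).twoMatchings.card = 9 * h ^ 2 + 9 * h + 4 := by
  have hverts : c.toSubgraph.verts = ↑(Finset.univ.image c) := by
    ext v
    rw [c.mem_verts_toSubgraph]
    simp
  rw [hverts]
  refine card_twoMatchings_awayFrom G hreg h hcard _ ?_ ?_ ?_
  · rw [Finset.card_image_of_injective _ (f := c) c.injective]
    rfl
  · intro x hx
    obtain ⟨i, -, rfl⟩ := Finset.mem_image.1 hx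
    have : G.neighborFinset (c i) ∩ Finset.univ.image c =
        ((cycleGraph 4).neighborFinset i).image c := by
      ext v
      simp only [Finset.mem_inter, mem_neighborFinset, Finset.mem_image, Finset.mem_univ, true_and]
      constructor
      · rintro ⟨hadj, j, rfl⟩
        exact ⟨j, (c.adj_iff_of_cycleGraph_four hbip).1 hadj, rfl⟩
      · rintro ⟨j, hadj, rfl⟩
        exact ⟨(c.adj_iff_of_cycleGraph_four hbip).2 hadj, j, rfl⟩
    rw [this, Finset.card_image_of_injective _ (f := c) c.injective]
    exact (by decide : ∀ i : Fin 4, ((cycleGraph 4).neighborFinset i).card = 2) i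
  · intro v hv
    have hvc : ∀ i, c i ≠ v := fun i hi => hv (Finset.mem_image.2 ⟨i, Finset.mem_univ _, hi⟩)
    rw [Finset.card_le_one]
    intro x hx y hy
    simp only [Finset.mem_inter, mem_neighborFinset, Finset.mem_image, Finset.mem_univ,
      true_and] at hx hy
    obtain ⟨hvx, i, rfl⟩ := hx
    obtain ⟨hvy, j, rfl⟩ := hy
    by_contra hne
    have hij : i ≠ j := fun h => hne (h ▸ rfl)
    have hnadj : ¬ (cycleGraph 4).Adj i j := by
      intro hadj
      obtain ⟨col⟩ := hbip
      have h1 := col.valid hvx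
      have h2 := col.valid hvy
      have h3 := col.valid (c.toHom.map_adj hadj)
      change col (c i) ≠ col (c j) at h3
      lia
    have key : ∀ i j : Fin 4, i ≠ j → ¬ (cycleGraph 4).Adj i j →
        ∃ k, (cycleGraph 4).Adj i k ∧ (cycleGraph 4).Adj k j := by decide
    obtain ⟨k, hik, hkj⟩ := key i j hij hnadj
    have hadj : ∀ a b : Fin 4, (cycleGraph 4).Adj a b →
        G.Adj (![v, c i, c k, c j] a) (![v, c i, c k, c j] b) := by
      have h1 : G.Adj (c i) (c k) := c.toHom.map_adj hik
      have h2 : G.Adj (c k) (c j) := c.toHom.map_adj hkj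
      intro a b hab
      fin_cases a <;> fin_cases b <;>
        first
        | exact absurd hab (by decide)
        | simp [hvx, hvx.symm, hvy, hvy.symm, h1, h1.symm, h2, h2.symm]
    have hinj : Function.Injective ![v, c i, c k, c j] := by
      have h1 : c i ≠ c k := fun h => hik.ne (c.injective h)
      have h2 : c k ≠ c j := fun h => hkj.ne (c.injective h)
      intro a b hab
      fin_cases a <;> fin_cases b <;>
        simp_all [(hvc _).symm, h1.symm, h2.symm, Ne.symm hne]
    let c' : Copy (cycleGraph 4) G := ⟨⟨![v, c i, c k, c j], fun {a b} => hadj a b⟩, hinj⟩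
    have hle := hshare c.toSubgraph c'.toSubgraph
      (nonempty_coe_iso_iff_exists_copy.2 ⟨c, rfl⟩) (nonempty_coe_iso_iff_exists_copy.2 ⟨c', rfl⟩)
      (fun heq => by
        obtain ⟨l, hl⟩ := c.mem_verts_toSubgraph.1 (heq ▸ c'.mem_verts_toSubgraph.2 ⟨0, rfl⟩)
        exact hvc l hl)
    refine absurd hle (not_le.2 ?_)
    rw [Set.one_lt_ncard_iff (Set.toFinite _)]
    refine ⟨s(c i, c k), s(c k, c j), ⟨?_, ?_⟩, ⟨?_, ?_⟩, ?_⟩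
    · exact ⟨i, k, hik, rfl, rfl⟩
    · exact ⟨1, 2, show (cycleGraph 4).Adj 1 2 by decide, rfl, rfl⟩
    · exact ⟨k, j, hkj, rfl, rfl⟩
    · exact ⟨2, 3, show (cycleGraph 4).Adj 2 3 by decide, rfl, rfl⟩
    · rw [Sym2.eq_swap]
      exact fun h => hne (Sym2.congr_right.1 h)

end FourCycle

section TwoEdges

lemma pathGraph_two_adj {i j : Fin 2} :
    (pathGraph 2).Adj i j ↔ i = 0 ∧ j = 1 ∨ i = 1 ∧ j = 0 := by
  revert i j
  simp only [pathGraph_adj]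
  decide

/-- The first component of a copy of a graph together with two disjoint edges. -/
def Copy.restrictLeft (f : Copy (X ⊕g pathGraph 2 ⊕g pathGraph 2) G) : Copy X G :=
  f.comp ((Embedding.sumInl.toCopy).comp Embedding.sumInl.toCopy)

lemma Copy.toSubgraph_eq_addEdges [DecidableEq V]
    (f : Copy (X ⊕g pathGraph 2 ⊕g pathGraph 2) G) :
    f.toSubgraph = f.restrictLeft.toSubgraph.addEdges
      {s(f (.inl (.inr 0)), f (.inl (.inr 1))), s(f (.inr 0), f (.inr 1))} := by
  have h1 : G.Adj (f (.inl (.inr 0))) (f (.inl (.inr 1))) :=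
    f.toHom.map_adj (by simp [pathGraph_two_adj])
  have h2 : G.Adj (f (.inr 0)) (f (.inr 1)) := f.toHom.map_adj (by simp [pathGraph_two_adj])
  have hleft : ∀ i, f.restrictLeft i = f (.inl (.inl i)) := fun _ => rfl
  ext u v
  · rw [f.mem_verts_toSubgraph, Subgraph.mem_verts_addEdges, Copy.mem_verts_toSubgraph]
    constructor
    · rintro ⟨(i | i) | i, rfl⟩
      · exact Or.inl ⟨i, rfl⟩
      · fin_cases i
        · exact Or.inr ⟨_, h1, by simp⟩
        · exact Or.inr ⟨_, h1.symm, by simp⟩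
      · fin_cases i
        · exact Or.inr ⟨_, h2, by simp⟩
        · exact Or.inr ⟨_, h2.symm, by simp⟩
    · rintro (⟨i, rfl⟩ | ⟨w, -, hw⟩)
      · exact ⟨_, (hleft i).symm⟩
      · simp only [Finset.mem_insert, Finset.mem_singleton, Sym2.eq_iff] at hw
        rcases hw with (⟨rfl, -⟩ | ⟨rfl, -⟩) | (⟨rfl, -⟩ | ⟨rfl, -⟩) <;> exact ⟨_, rfl⟩
  · rw [f.toSubgraph_adj, Subgraph.addEdges_adj, Copy.toSubgraph_adj]
    constructor
    · rintro ⟨(i | i) | i, (j | j) | j, hij, rfl, rfl⟩ <;>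
        simp [pathGraph_two_adj] at hij
      · exact Or.inl ⟨i, j, hij, rfl, rfl⟩
      · rcases hij with ⟨rfl, rfl⟩ | ⟨rfl, rfl⟩
        · exact Or.inr ⟨h1, by simp⟩
        · exact Or.inr ⟨h1.symm, by simp⟩
      · rcases hij with ⟨rfl, rfl⟩ | ⟨rfl, rfl⟩
        · exact Or.inr ⟨h2, by simp⟩
        · exact Or.inr ⟨h2.symm, by simp⟩
    · rintro (⟨i, j, hij, rfl, rfl⟩ | ⟨-, hw⟩)
      · exact ⟨_, _, by simpa using hij, (hleft i).symm, (hleft j).symm⟩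
      · simp only [Finset.mem_insert, Finset.mem_singleton, Sym2.eq_iff] at hw
        rcases hw with (⟨rfl, rfl⟩ | ⟨rfl, rfl⟩) | (⟨rfl, rfl⟩ | ⟨rfl, rfl⟩) <;>
          exact ⟨_, _, by simp [pathGraph_two_adj], rfl, rfl⟩

lemma Copy.mem_twoMatchings_awayFrom_restrictLeft [Fintype V] [DecidableEq V]
    (f : Copy (X ⊕g pathGraph 2 ⊕g pathGraph 2) G) :
    {s(f (.inl (.inr 0)), f (.inl (.inr 1))), s(f (.inr 0), f (.inr 1))} ∈
      (G.awayFrom f.restrictLeft.toSubgraph.verts).twoMatchings := by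
  have h1 : G.Adj (f (.inl (.inr 0))) (f (.inl (.inr 1))) :=
    f.toHom.map_adj (by simp [pathGraph_two_adj])
  have h2 : G.Adj (f (.inr 0)) (f (.inr 1)) := f.toHom.map_adj (by simp [pathGraph_two_adj])
  have hleft : ∀ i, f.restrictLeft i = f (.inl (.inl i)) := fun _ => rfl
  have hf : ∀ {i j}, f i = f j ↔ i = j := f.injective.eq_iff
  have hdisj : ∀ v, v ∈ s(f (.inl (.inr 0)), f (.inl (.inr 1))) →
      v ∉ s(f (.inr 0), f (.inr 1)) := by
    intro v hv
    rw [Sym2.mem_iff] at hv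
    rcases hv with rfl | rfl <;> simp [hf]
  rw [mem_twoMatchings]
  refine ⟨⟨?_, Finset.card_pair fun h => hdisj (f (.inr 0)) (h ▸ Sym2.mem_mk_left _ _)
    (Sym2.mem_mk_left _ _)⟩, ?_⟩
  · intro e he
    simp only [Finset.mem_insert, Finset.mem_singleton] at he
    rcases he with rfl | rfl <;>
      simp [awayFrom_adj, h1, h2, -Subgraph.map_verts, Copy.mem_verts_toSubgraph, hleft, hf]
  · intro v e he e' he' hv hv'
    simp only [Finset.mem_insert, Finset.mem_singleton] at he he'
    rcases he with rfl | rfl <;> rcases he' with rfl | rfl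
    · rfl
    · exact absurd hv' (hdisj v hv)
    · exact absurd hv (hdisj v hv')
    · rfl

lemma Copy.exists_toSubgraph_eq_addEdges [Fintype V] [DecidableEq V] (c : Copy X G)
    {s : Finset (Sym2 V)} (hs : s ∈ (G.awayFrom c.toSubgraph.verts).twoMatchings) :
    ∃ f : Copy (X ⊕g pathGraph 2 ⊕g pathGraph 2) G,
      f.toSubgraph = c.toSubgraph.addEdges s := by
  rw [mem_twoMatchings] at hs
  obtain ⟨⟨hE, h2⟩, hM⟩ := hs
  obtain ⟨e, e', hne, rfl⟩ := Finset.card_eq_two.1 h2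
  induction e with | _ x y
  induction e' with | _ z w
  have hxy := hE s(x, y) (by simp)
  have hzw := hE s(z, w) (by simp)
  rw [mem_edgeSet, awayFrom_adj] at hxy hzw
  have hdisj : ∀ v, v ∈ s(x, y) → v ∉ s(z, w) := fun v hv hv' =>
    hne (hM v _ (by simp) _ (by simp) hv hv')
  have hxz := hdisj x (by simp)
  have hyz := hdisj y (by simp)
  rw [Sym2.mem_iff, not_or] at hxz hyz
  have hc : ∀ i v, v ∉ c.toSubgraph.verts → c i ≠ v := fun i v hv h =>
    hv (c.mem_verts_toSubgraph.2 ⟨i, h⟩)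
  let g : (W ⊕ Fin 2) ⊕ Fin 2 → V := Sum.elim (Sum.elim c ![x, y]) ![z, w]
  have hadj : ∀ a b, (X ⊕g pathGraph 2 ⊕g pathGraph 2).Adj a b → G.Adj (g a) (g b) := by
    rintro ((i | i) | i) ((j | j) | j) hij <;> simp [pathGraph_two_adj] at hij
    · exact c.toHom.map_adj hij
    · rcases hij with ⟨rfl, rfl⟩ | ⟨rfl, rfl⟩
      exacts [hxy.1, hxy.1.symm]
    · rcases hij with ⟨rfl, rfl⟩ | ⟨rfl, rfl⟩
      exacts [hzw.1, hzw.1.symm]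
  have hg : Function.Injective g := by
    refine Function.Injective.sumElim (Function.Injective.sumElim c.injective ?_ ?_) ?_ ?_
    · simp [Function.Injective, Fin.forall_fin_two, hxy.1.ne, hxy.1.ne']
    · intro i j
      fin_cases j
      exacts [hc i x hxy.2.1, hc i y hxy.2.2]
    · simp [Function.Injective, Fin.forall_fin_two, hzw.1.ne, hzw.1.ne']
    · rintro (i | i) j <;> fin_cases j
      · exact hc i z hzw.2.1
      · exact hc i w hzw.2.2
      all_goals fin_cases i
      exacts [hxz.1, hyz.1, hxz.2, hyz.2]
  exact ⟨⟨⟨g, fun {a b} => hadj a b⟩, hg⟩, Copy.toSubgraph_eq_addEdges _⟩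

end TwoEdges

end SimpleGraph

theorem stmt_11 {V : Type*} [Fintype V] [DecidableEq V] (G : SimpleGraph V) [DecidableRel G.Adj]
    (hreg : G.IsRegularOfDegree 3) (hbip : G.Colorable 2) (h : ℕ)
    (hcard : Fintype.card V = 2 * h + 8)
    (hsix : numSubgraphs G (cycleGraph 4) = 6)
    (hshare : ∀ H₁ H₂ : G.Subgraph, Nonempty (H₁.coe ≃g cycleGraph 4) →
      Nonempty (H₂.coe ≃g cycleGraph 4) → H₁ ≠ H₂ →
      (H₁.edgeSet ∩ H₂.edgeSet).ncard ≤ 1) :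
    numSubgraphs G (cycleGraph 4 ⊕g pathGraph 2 ⊕g pathGraph 2) = 27 * h ^ 2 + 27 * h + 12 := by
  classical
  have hfin : {H : G.Subgraph | Nonempty (H.coe ≃g cycleGraph 4)}.Finite := Set.toFinite _
  rw [numSubgraphs, Set.ncard_eq_toFinset_card _ hfin] at hsix
  have hmem : ∀ {C}, C ∈ hfin.toFinset ↔ ∃ c : Copy (cycleGraph 4) G, c.toSubgraph = C := by
    intro C
    rw [Set.Finite.mem_toFinset]
    exact nonempty_coe_iso_iff_exists_copy
  set P := hfin.toFinset.sigma fun C => (G.awayFrom C.verts).twoMatchings with hP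
  have himage : {H : G.Subgraph | Nonempty (H.coe ≃g cycleGraph 4 ⊕g pathGraph 2 ⊕g pathGraph 2)} =
      (fun p : (_ : G.Subgraph) × Finset (Sym2 V) => p.1.addEdges p.2) '' P := by
    ext H
    rw [Set.mem_ofPred_eq, nonempty_coe_iso_iff_exists_copy]
    constructor
    · rintro ⟨f, rfl⟩
      exact ⟨⟨_, _⟩, Finset.mem_coe.2 (Finset.mem_sigma.2 ⟨hmem.2 ⟨f.restrictLeft, rfl⟩,
        f.mem_twoMatchings_awayFrom_restrictLeft⟩), f.toSubgraph_eq_addEdges.symm⟩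
    · rintro ⟨⟨C, s⟩, hp, rfl⟩
      obtain ⟨hC, hs⟩ := Finset.mem_sigma.1 (Finset.mem_coe.1 hp)
      obtain ⟨c, rfl⟩ := hmem.1 hC
      exact c.exists_toSubgraph_eq_addEdges hs
  have hinj : Set.InjOn (fun p : (_ : G.Subgraph) × Finset (Sym2 V) => p.1.addEdges p.2) P := by
    rintro ⟨C, s⟩ hp ⟨C', s'⟩ hp' heq
    obtain ⟨hC, hs⟩ := Finset.mem_sigma.1 (Finset.mem_coe.1 hp)
    obtain ⟨hC', hs'⟩ := Finset.mem_sigma.1 (Finset.mem_coe.1 hp')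
    obtain ⟨c, rfl⟩ := hmem.1 hC
    obtain ⟨c', rfl⟩ := hmem.1 hC'
    dsimp only at hs hs' heq
    have hadj : ∀ u v, c.toSubgraph.Adj u v ↔ c'.toSubgraph.Adj u v := by
      intro u v
      rw [Subgraph.adj_iff_addEdges_adj hs c.exists_ne_adj_of_cycleGraph_four,
        Subgraph.adj_iff_addEdges_adj hs' c'.exists_ne_adj_of_cycleGraph_four, heq]
    have hcc : c.toSubgraph = c'.toSubgraph := by
      ext u v
      · rw [c.exists_adj_of_mem_verts_cycleGraph_four, c'.exists_adj_of_mem_verts_cycleGraph_four]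
        exact exists_congr fun v => hadj u v
      · exact hadj u v
    have hss : s = s' := by
      ext e
      induction e with | _ u v
      rw [Subgraph.mem_twoMatchings_awayFrom_iff_addEdges_adj hs,
        Subgraph.mem_twoMatchings_awayFrom_iff_addEdges_adj hs', heq, hadj]
    rw [hcc, hss]
  rw [numSubgraphs, himage, hinj.ncard_image, Set.ncard_coe_finset, hP,
    Finset.card_sigma]
  have hsum : 2 * ∑ C ∈ hfin.toFinset, (G.awayFrom C.verts).twoMatchings.card =
      6 * (9 * h ^ 2 + 9 * h + 4) := by
    rw [Finset.mul_sum, ← hsix, ← smul_eq_mul (Finset.card _), ← Finset.sum_const]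
    refine Finset.sum_congr rfl fun C hC => ?_
    obtain ⟨c, rfl⟩ := hmem.1 hC
    exact card_twoMatchings_awayFrom_cycleGraph_four c hreg hbip h hcard hshare
  lia
end

section
/- Let G be a finite simple 3-regular bipartite graph on exactly 2h+8 vertices (h a natural number) having exactly six cycles of length 4, any two distinct 4-cycles of G sharing at most one edge. Then N(P₃+2K₂) = 54h³ + 234h² + 180h + 72. -/
open SimpleGraph

namespace SimpleGraph

variable {V W : Type*}

/-- A copy of `X` in `G` amounts to a subgraph of `G` with an isomorphism from `X`. -/
noncomputable def sigmaIsoEquivCopy (G : SimpleGraph V) (X : SimpleGraph W) :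
    (Σ H : {H : G.Subgraph // Nonempty (H.coe ≃g X)}, X ≃g H.1.coe) ≃ Copy X G :=
  Equiv.ofBijective (fun p ↦ p.1.1.coeCopy.comp p.2.toCopy) <| by
    constructor
    · rintro ⟨⟨H, hH⟩, e⟩ ⟨⟨K, hK⟩, e'⟩ hee
      have key : ∀ (H : G.Subgraph) (e : X ≃g H.coe),
          (H.coeCopy.comp e.toCopy).toSubgraph = H := by
        intro H e
        ext u v
        · simp only [Subgraph.map_verts, Subgraph.verts_top, Set.image_univ, Set.mem_range]
          constructor
          · rintro ⟨w, rfl⟩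
            exact (e w).2
          · intro hu
            exact ⟨e.symm ⟨u, hu⟩, congrArg Subtype.val (e.apply_symm_apply ⟨u, hu⟩)⟩
        · simp only [Subgraph.map_adj, Relation.Map, Subgraph.top_adj]
          constructor
          · rintro ⟨w, w', hw, rfl, rfl⟩
            exact e.map_adj_iff.2 hw
          · intro huv
            refine ⟨e.symm ⟨u, huv.fst_mem⟩, e.symm ⟨v, huv.snd_mem⟩, ?_,
              congrArg Subtype.val (e.apply_symm_apply ⟨u, huv.fst_mem⟩),
              congrArg Subtype.val (e.apply_symm_apply ⟨v, huv.snd_mem⟩)⟩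
            exact e.symm.map_adj_iff.2 huv
      obtain rfl : H = K := by
        rw [← key H e, ← key K e']
        exact congrArg Copy.toSubgraph hee
      have : e = e' := by
        ext w
        exact DFunLike.congr_fun hee w
      rw [this]
    · intro f
      refine ⟨⟨⟨f.toSubgraph, ⟨f.isoToSubgraph.symm⟩⟩, f.isoToSubgraph⟩, ?_⟩
      ext w
      rfl

/-- Over a finite vertex type, a self-copy of a graph is an automorphism. -/
noncomputable def isoEquivSelfCopy [Finite W] (X : SimpleGraph W) : (X ≃g X) ≃ Copy X X :=
  Equiv.ofBijective (fun e ↦ e.toCopy) <| by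
    constructor
    · intro e e' hee
      ext w
      exact DFunLike.congr_fun hee w
    · intro f
      refine ⟨⟨Equiv.ofBijective f (Finite.injective_iff_bijective.1 f.injective), ?_⟩, ?_⟩
      · intro u v
        refine ⟨fun huv ↦ ?_, fun huv ↦ f.toHom.map_adj huv⟩
        obtain ⟨⟨x, hx⟩, hxe⟩ := Finite.injective_iff_surjective.1 f.mapEdgeSet.injective
          ⟨s(f u, f v), huv⟩
        induction x using Sym2.inductionOn with
        | hf a b =>
          have hab : Sym2.map f s(a, b) = Sym2.map f s(u, v) := congrArg Subtype.val hxe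
          rw [Sym2.map.injective f.injective hab] at hx
          exact hx
      · ext w
        rfl

theorem natCard_copy_eq [Finite W] (G : SimpleGraph V) (X : SimpleGraph W) :
    Nat.card (Copy X G) = numSubgraphs G X * Nat.card (Copy X X) := by
  rw [← Nat.card_congr (isoEquivSelfCopy X), numSubgraphs, ← Nat.card_coe_set_eq, ← Nat.card_prod]
  exact Nat.card_congr ((sigmaIsoEquivCopy G X).symm.trans ((Equiv.sigmaCongrRight fun H ↦
    RelIso.relIsoCongr (RelIso.refl _) H.2.some).trans (Equiv.sigmaEquivProd _ _)))

theorem natCard_copy_cycleGraph_four [Fintype V] [DecidableEq V] (G : SimpleGraph V)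
    [DecidableRel G.Adj] :
    Nat.card (Copy (cycleGraph 4) G) =
      ∑ a, ∑ b, if G.Adj a b then ∑ c, if G.Adj b c ∧ a ≠ c then ∑ d,
        if G.Adj c d ∧ G.Adj d a ∧ b ≠ d then 1 else 0 else 0 else 0 := by
  classical
  have e : Copy (cycleGraph 4) G ≃ {t : V × V × V × V // G.Adj t.1 t.2.1 ∧
      (G.Adj t.2.1 t.2.2.1 ∧ t.1 ≠ t.2.2.1) ∧
      (G.Adj t.2.2.1 t.2.2.2 ∧ G.Adj t.2.2.2 t.1 ∧ t.2.1 ≠ t.2.2.2)} :=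
    { toFun := fun f ↦ ⟨(f 0, f 1, f 2, f 3), by
        have hadj : ∀ i j, (cycleGraph 4).Adj i j → G.Adj (f i) (f j) := fun i j hij ↦
          f.toHom.map_adj hij
        have hne : ∀ i j, i ≠ j → f i ≠ f j := fun i j hij ↦ f.injective.ne hij
        refine ⟨hadj _ _ ?_, ⟨hadj _ _ ?_, hne _ _ ?_⟩, hadj _ _ ?_, hadj _ _ ?_, hne _ _ ?_⟩ <;>
          (simp [cycleGraph_adj]; try decide)⟩
      invFun := fun t ↦
        { toHom :=
            { toFun := ![t.1.1, t.1.2.1, t.1.2.2.1, t.1.2.2.2]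
              map_rel' := by
                obtain ⟨⟨a, b, c, d⟩, hab, ⟨hbc, hac⟩, hcd, hda, hbd⟩ := t
                intro i j hij
                have := hab.symm
                have := hbc.symm
                have := hcd.symm
                have := hda.symm
                rw [cycleGraph_adj] at hij
                fin_cases i <;> fin_cases j <;>
                  first
                  | assumption
                  | exact absurd hij (by decide) }
          injective' := by
            obtain ⟨⟨a, b, c, d⟩, hab, ⟨hbc, hac⟩, hcd, hda, hbd⟩ := t
            have := hab.ne
            have := hbc.ne
            have := hcd.ne
            have := hda.ne
            intro i j hij
            fin_cases i <;> fin_cases j <;>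
              first
              | rfl
              | exact absurd hij (by assumption)
              | exact absurd hij.symm (by assumption) }
      left_inv := fun f ↦ by
        ext i
        fin_cases i <;> rfl
      right_inv := fun t ↦ rfl }
  rw [Nat.card_congr e, Nat.card_eq_fintype_card, Fintype.card_subtype, Finset.card_filter]
  simp only [Fintype.sum_prod_type, ite_and, Finset.sum_ite_irrel, Finset.sum_const_zero]

theorem natCard_copy_path_edge_edge [Fintype V] [DecidableEq V] (G : SimpleGraph V)
    [DecidableRel G.Adj] :
    Nat.card (Copy (pathGraph 4 ⊕g pathGraph 2 ⊕g pathGraph 2) G) =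
      ∑ a, ∑ b, if G.Adj a b then ∑ c, if G.Adj b c ∧ a ≠ c then ∑ d,
        if G.Adj c d ∧ b ≠ d ∧ a ≠ d then
          ∑ e, ∑ f, if G.Adj e f ∧ (e ≠ a ∧ e ≠ b ∧ e ≠ c ∧ e ≠ d) ∧
              (f ≠ a ∧ f ≠ b ∧ f ≠ c ∧ f ≠ d) then
            ∑ g, ∑ i, if G.Adj g i ∧ (g ≠ a ∧ g ≠ b ∧ g ≠ c ∧ g ≠ d) ∧
              (i ≠ a ∧ i ≠ b ∧ i ≠ c ∧ i ≠ d) ∧ (g ≠ e ∧ g ≠ f ∧ i ≠ e ∧ i ≠ f) then 1 else 0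
          else 0 else 0 else 0 else 0 := by
  classical
  have e : Copy (pathGraph 4 ⊕g pathGraph 2 ⊕g pathGraph 2) G ≃
      {t : V × V × V × V × V × V × V × V // match t with
        | (a, b, c, d, e, f, g, i) => G.Adj a b ∧ (G.Adj b c ∧ a ≠ c) ∧
          (G.Adj c d ∧ b ≠ d ∧ a ≠ d) ∧
          (G.Adj e f ∧ (e ≠ a ∧ e ≠ b ∧ e ≠ c ∧ e ≠ d) ∧ (f ≠ a ∧ f ≠ b ∧ f ≠ c ∧ f ≠ d)) ∧
          (G.Adj g i ∧ (g ≠ a ∧ g ≠ b ∧ g ≠ c ∧ g ≠ d) ∧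
              (i ≠ a ∧ i ≠ b ∧ i ≠ c ∧ i ≠ d) ∧ (g ≠ e ∧ g ≠ f ∧ i ≠ e ∧ i ≠ f))} :=
    { toFun := fun f ↦ ⟨(f (.inl (.inl 0)), f (.inl (.inl 1)), f (.inl (.inl 2)),
          f (.inl (.inl 3)), f (.inl (.inr 0)), f (.inl (.inr 1)), f (.inr 0), f (.inr 1)), by
        have hadj : ∀ i j, (pathGraph 4 ⊕g pathGraph 2 ⊕g pathGraph 2).Adj i j →
          G.Adj (f i) (f j) := fun i j hij ↦ f.toHom.map_adj hij
        have hne : ∀ i j, i ≠ j → f i ≠ f j := fun i j hij ↦ f.injective.ne hij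
        refine ⟨hadj _ _ ?_, ⟨hadj _ _ ?_, hne _ _ ?_⟩, ⟨hadj _ _ ?_, hne _ _ ?_, hne _ _ ?_⟩,
          ⟨hadj _ _ ?_, ⟨hne _ _ ?_, hne _ _ ?_, hne _ _ ?_, hne _ _ ?_⟩,
            hne _ _ ?_, hne _ _ ?_, hne _ _ ?_, hne _ _ ?_⟩,
          hadj _ _ ?_, ⟨hne _ _ ?_, hne _ _ ?_, hne _ _ ?_, hne _ _ ?_⟩,
            ⟨hne _ _ ?_, hne _ _ ?_, hne _ _ ?_, hne _ _ ?_⟩,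
            hne _ _ ?_, hne _ _ ?_, hne _ _ ?_, hne _ _ ?_⟩ <;>
          simp [pathGraph_adj]⟩
      invFun := fun t ↦
        { toHom :=
            { toFun := match t with
                | ⟨(a, b, c, d, e, f, g, i), _⟩ =>
                  Sum.elim (Sum.elim ![a, b, c, d] ![e, f]) ![g, i]
              map_rel' := by
                obtain ⟨⟨a, b, c, d, e, f, g, i⟩, hab, ⟨hbc, _⟩, ⟨hcd, _⟩, ⟨hef, _⟩, hgi, _⟩ := t
                simp [Sum.forall, Fin.forall_fin_succ, pathGraph_adj, hab, hbc, hcd, hef, hgi,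
                  hab.symm, hbc.symm, hcd.symm, hef.symm, hgi.symm] }
          injective' := by
            obtain ⟨⟨a, b, c, d, e, f, g, i⟩, hab, ⟨hbc, hac⟩, ⟨hcd, hbd, had⟩,
              ⟨hef, ⟨ha, hb, hc, hd⟩, ka, kb, kc, kd⟩, hgi, ⟨la, lb, lc, ld⟩, ⟨ma, mb, mc, md⟩,
              ge, gf, ie, jf⟩ := t
            refine Function.Injective.sumElim (Function.Injective.sumElim ?_ ?_ ?_) ?_ ?_ <;>
              simp [Function.Injective, Sum.forall, Fin.forall_fin_succ, hab.ne, hab.ne', hbc.ne,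
                hbc.ne', hcd.ne, hcd.ne', hef.ne, hef.ne', hgi.ne, hgi.ne', hac, hac.symm, hbd,
                hbd.symm, had, had.symm, ha.symm, hb.symm, hc.symm, hd.symm, ka.symm, kb.symm,
                kc.symm, kd.symm, la.symm, lb.symm, lc.symm, ld.symm, ma.symm, mb.symm, mc.symm,
                md.symm, ge.symm, gf.symm, ie.symm, jf.symm] }
      left_inv := fun f ↦ by
        ext x
        obtain (x | x) | x := x <;> fin_cases x <;> rfl
      right_inv := fun t ↦ rfl }
  rw [Nat.card_congr e, Nat.card_eq_fintype_card, Fintype.card_subtype, Finset.card_filter]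
  simp only [Fintype.sum_prod_type, ite_and, Finset.sum_ite_irrel, Finset.sum_const_zero]

theorem natCard_copy_cycleGraph_four_self :
    Nat.card (Copy (cycleGraph 4) (cycleGraph 4)) = 8 := by
  rw [natCard_copy_cycleGraph_four]
  decide +kernel

theorem natCard_copy_path_edge_edge_self :
    Nat.card (Copy (pathGraph 4 ⊕g pathGraph 2 ⊕g pathGraph 2)
      (pathGraph 4 ⊕g pathGraph 2 ⊕g pathGraph 2)) = 16 := by
  let R : (Fin 4 ⊕ Fin 2) ⊕ Fin 2 → (Fin 4 ⊕ Fin 2) ⊕ Fin 2 → Bool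
    | .inl (.inl x), .inl (.inl y) => x.val + 1 = y.val ∨ y.val + 1 = x.val
    | .inl (.inr x), .inl (.inr y) => x ≠ y
    | .inr x, .inr y => x ≠ y
    | _, _ => false
  let _ : DecidableRel (pathGraph 4 ⊕g pathGraph 2 ⊕g pathGraph 2).Adj := fun x y ↦
    decidable_of_iff (R x y = true) <| by
      obtain (x | x) | x := x <;> obtain (y | y) | y := y <;> simp [R, pathGraph_adj] <;> omega
  rw [natCard_copy_path_edge_edge]
  decide +kernel

/-- The number of ordered pairs of disjoint oriented edges of a graph, in terms of degrees. -/
theorem sum_disjoint_darts [Fintype V] [DecidableEq V] (r : V → V → Prop) [DecidableRel r]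
    (hsymm : ∀ x y, r x y → r y x) (hirr : ∀ x, ¬ r x x) (d : V → ℤ) (hd : ∀ x, d x = ∑ y, if r x y then 1 else 0) :
    (∑ e, ∑ f, if r e f then
      ∑ g, ∑ i, if r g i ∧ (g ≠ e ∧ g ≠ f ∧ i ≠ e ∧ i ≠ f) then (1 : ℤ) else 0 else 0) =
      (∑ x, d x) * (∑ x, d x + 2) - 4 * ∑ x, d x ^ 2 := by
  set w : V → V → ℤ := fun x y ↦ if r x y then 1 else 0 with hw
  have hws : ∀ x y, w x y = w y x := fun x y ↦ by
    have : r x y ↔ r y x := ⟨hsymm x y, hsymm y x⟩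
    simp only [hw, this]
  have hww : ∀ x, w x x = 0 := fun x ↦ by simp [hw, hirr]
  have hd' : ∀ x, ∑ y, w x y = d x := fun x ↦ (hd x).symm
  have hd'' : ∀ x, ∑ y, w y x = d x := fun x ↦ by simp only [hws _ x, hd']
  have inner : ∀ e f, r e f →
      (∑ g, ∑ i, if r g i ∧ (g ≠ e ∧ g ≠ f ∧ i ≠ e ∧ i ≠ f) then (1 : ℤ) else 0) =
        ∑ x, d x - 2 * d e - 2 * d f + 2 := by
    intro e f hef
    have hne : e ≠ f := fun h ↦ hirr f (h ▸ hef)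
    have hwef : w e f = 1 := if_pos hef
    have hwfe : w f e = 1 := (hws f e).trans hwef
    have step : ∀ g i, (if r g i ∧ (g ≠ e ∧ g ≠ f ∧ i ≠ e ∧ i ≠ f) then (1 : ℤ) else 0) =
        w g i - (if g = e then w e i else 0) - (if g = f then w f i else 0)
          - ((if i = e then w g e else 0) + (if i = f then w g f else 0))
          + ((if i = e then if g = e then w e e else 0 else 0)
          + (if i = e then if g = f then w f e else 0 else 0)
          + (if i = f then if g = e then w e f else 0 else 0)
          + (if i = f then if g = f then w f f else 0 else 0)) := by
      intro g i
      by_cases h1 : g = e <;> by_cases h2 : g = f <;> by_cases h3 : i = e <;>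
        by_cases h4 : i = f <;> simp_all
    simp only [step, Finset.sum_add_distrib, Finset.sum_sub_distrib, Finset.sum_ite_eq',
      Finset.sum_ite_irrel, Finset.sum_const_zero, Finset.mem_univ, if_true, hd', hd'', hww, hwef,
      hwfe]
    ring
  have outer : ∀ e f, (if r e f then
      ∑ g, ∑ i, if r g i ∧ (g ≠ e ∧ g ≠ f ∧ i ≠ e ∧ i ≠ f) then (1 : ℤ) else 0 else 0) =
      (∑ x, d x + 2) * w e f - 2 * (d e * w e f) - 2 * (w e f * d f) := by
    intro e f
    by_cases hef : r e f
    · have hwef : w e f = 1 := if_pos hef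
      rw [if_pos hef, inner e f hef, hwef]
      ring
    · have hwef : w e f = 0 := if_neg hef
      rw [if_neg hef, hwef]
      ring
  simp only [outer, Finset.sum_sub_distrib, ← Finset.mul_sum, hd']
  rw [Finset.sum_comm (f := fun e f ↦ w e f * d f)]
  simp only [← Finset.sum_mul, hd'', ← pow_two]
  ring

/-- The `0`-`1` adjacency function of a graph. -/
def adjInd (G : SimpleGraph V) [DecidableRel G.Adj] (x y : V) : ℤ := if G.Adj x y then 1 else 0

variable (G : SimpleGraph V) [DecidableRel G.Adj]

theorem adjInd_comm (x y : V) : G.adjInd x y = G.adjInd y x := by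
  simp only [adjInd, G.adj_comm]

theorem adjInd_self (x : V) : G.adjInd x x = 0 := by simp [adjInd]

theorem adjInd_mul_self (x y : V) : G.adjInd x y * G.adjInd x y = G.adjInd x y := by
  simp [adjInd]

variable {G}

theorem sum_adjInd [Fintype V] (hreg : G.IsRegularOfDegree 3) (x : V) : ∑ y, G.adjInd x y = 3 := by
  have := hreg x
  rw [← G.card_neighborFinset_eq_degree, neighborFinset_eq_filter] at this
  simp only [adjInd, Finset.sum_boole, this]
  rfl

theorem sum_adjInd' [Fintype V] (hreg : G.IsRegularOfDegree 3) (x : V) : ∑ y, G.adjInd y x = 3 := by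
  simp only [G.adjInd_comm _ x, sum_adjInd hreg]

theorem Coloring.adjInd_eq_zero (C : G.Coloring (Fin 2)) {x y : V} (hxy : C x = C y) :
    G.adjInd x y = 0 :=
  if_neg fun h ↦ C.valid h hxy

theorem Coloring.adjInd_mul_eq_zero (C : G.Coloring (Fin 2)) {x y : V} (hxy : C x ≠ C y) (e : V) :
    G.adjInd e x * G.adjInd e y = 0 := by
  by_cases hx : C e = C x
  · rw [C.adjInd_eq_zero hx, zero_mul]
  · rw [C.adjInd_eq_zero (x := e) (y := y) (by omega), mul_zero]

/-- The number of ordered pairs of disjoint oriented edges avoiding a given path `abcd`. -/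
theorem sum_disjoint_darts_avoiding_path [Fintype V] [DecidableEq V]
    (hreg : G.IsRegularOfDegree 3) (C : G.Coloring (Fin 2))
    {a b c d : V} (hab : G.Adj a b) (hbc : G.Adj b c) (hcd : G.Adj c d) (hac : a ≠ c)
    (hbd : b ≠ d) (had : a ≠ d) :
    (∑ e, ∑ f, if G.Adj e f ∧ (e ≠ a ∧ e ≠ b ∧ e ≠ c ∧ e ≠ d) ∧
        (f ≠ a ∧ f ≠ b ∧ f ≠ c ∧ f ≠ d) then
      ∑ g, ∑ i, if G.Adj g i ∧ (g ≠ a ∧ g ≠ b ∧ g ≠ c ∧ g ≠ d) ∧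
        (i ≠ a ∧ i ≠ b ∧ i ≠ c ∧ i ≠ d) ∧ (g ≠ e ∧ g ≠ f ∧ i ≠ e ∧ i ≠ f) then (1 : ℤ) else 0
      else 0) =
      ((3 * Fintype.card V - 18) * (3 * Fintype.card V - 16) - 36 * Fintype.card V + 280)
        + (12 * Fintype.card V - 88) * G.adjInd a d
        - 8 * ∑ v, G.adjInd v a * G.adjInd v c - 8 * ∑ v, G.adjInd v b * G.adjInd v d := by
  set n : ℤ := (Fintype.card V : ℤ) with hn
  let r : V → V → Prop := fun e f ↦ G.Adj e f ∧ (e ≠ a ∧ e ≠ b ∧ e ≠ c ∧ e ≠ d) ∧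
        (f ≠ a ∧ f ≠ b ∧ f ≠ c ∧ f ≠ d)
  let s : V → ℤ := fun e ↦ (if e = a then 1 else 0) + (if e = b then 1 else 0)
    + (if e = c then 1 else 0) + (if e = d then 1 else 0)
  let k : V → ℤ := fun e ↦ G.adjInd e a + G.adjInd e b + G.adjInd e c + G.adjInd e d
  have hs : ∀ e, (e = a ∨ e = b ∨ e = c ∨ e = d) ∧ s e = 1 ∨
      (e ≠ a ∧ e ≠ b ∧ e ≠ c ∧ e ≠ d) ∧ s e = 0 := by
    intro e
    by_cases h1 : e = a <;> by_cases h2 : e = b <;> by_cases h3 : e = c <;>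
        by_cases h4 : e = d <;> simp_all [s, hab.ne, hbc.ne, hcd.ne]
  have hdeg : ∀ e, (1 - s e) * (3 - k e) = ∑ f, if r e f then 1 else 0 := by
    intro e
    obtain ⟨he, hse⟩ | ⟨he, hse⟩ := hs e
    · rw [hse, Finset.sum_eq_zero]
      · ring
      · exact fun f _ ↦ if_neg fun h ↦ by tauto
    · have step : ∀ f, (if r e f then (1 : ℤ) else 0) = G.adjInd e f
          - (if f = a then G.adjInd e a else 0) - (if f = b then G.adjInd e b else 0)
          - (if f = c then G.adjInd e c else 0) - (if f = d then G.adjInd e d else 0) := by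
        intro f
        by_cases h1 : f = a <;> by_cases h2 : f = b <;> by_cases h3 : f = c <;>
          by_cases h4 : f = d <;> simp_all [r, adjInd, hab.ne, hbc.ne, hcd.ne]
      simp only [step, Finset.sum_sub_distrib, Finset.sum_ite_eq', Finset.mem_univ, if_true,
        sum_adjInd hreg, hse, k]
      ring
  have key := sum_disjoint_darts r
    (fun x y h ↦ ⟨h.1.symm, h.2.2, h.2.1⟩) (fun x h ↦ h.1.ne rfl) _ hdeg
  have hCab := C.valid hab
  have hCbc := C.valid hbc
  have hCcd := C.valid hcd
  have ab1 : G.adjInd a b = 1 := if_pos hab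
  have bc1 : G.adjInd b c = 1 := if_pos hbc
  have cd1 : G.adjInd c d = 1 := if_pos hcd
  have ba1 : G.adjInd b a = 1 := if_pos hab.symm
  have cb1 : G.adjInd c b = 1 := if_pos hbc.symm
  have dc1 : G.adjInd d c = 1 := if_pos hcd.symm
  have ac0 : G.adjInd a c = 0 := C.adjInd_eq_zero (by omega)
  have ca0 : G.adjInd c a = 0 := C.adjInd_eq_zero (by omega)
  have bd0 : G.adjInd b d = 0 := C.adjInd_eq_zero (by omega)
  have db0 : G.adjInd d b = 0 := C.adjInd_eq_zero (by omega)
  have sum_s : ∀ φ : V → ℤ, ∑ e, s e * φ e = φ a + φ b + φ c + φ d := by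
    intro φ
    simp [s, add_mul, Finset.sum_add_distrib]
  have ka : k a = 1 + G.adjInd a d := by simp only [k, ab1, ac0, adjInd_self]; ring
  have kb : k b = 2 := by simp only [k, ba1, bc1, bd0, adjInd_self]; ring
  have kc : k c = 2 := by simp only [k, cb1, cd1, ca0, adjInd_self]; ring
  have kd : k d = 1 + G.adjInd a d := by
    simp only [k, dc1, db0, G.adjInd_comm d a, adjInd_self]; ring
  have hD : ∑ e, (1 - s e) * (3 - k e) = 3 * n - 18 + 2 * G.adjInd a d := by
    have : ∀ e, (1 - s e) * (3 - k e) = 3 - k e - s e * (3 - k e) := fun e ↦ by ring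
    simp only [this, Finset.sum_sub_distrib, sum_s, ka, kb, kc, kd]
    simp only [k, Finset.sum_add_distrib, sum_adjInd' hreg, Finset.sum_const, Finset.card_univ,
      nsmul_eq_mul, ← hn]
    ring
  have hε := G.adjInd_mul_self a d
  have hD2 : ∑ e, ((1 - s e) * (3 - k e)) ^ 2 = 9 * n - 70
      + 2 * ∑ v, G.adjInd v a * G.adjInd v c + 2 * ∑ v, G.adjInd v b * G.adjInd v d
      + 6 * G.adjInd a d := by
    have h1 : ∀ e, ((1 - s e) * (3 - k e)) ^ 2 = (3 - k e) ^ 2 - s e * (3 - k e) ^ 2 := by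
      intro e
      obtain ⟨_, hse⟩ | ⟨_, hse⟩ := hs e <;> rw [hse] <;> ring
    have h2 : ∀ e, (3 - k e) ^ 2 = 9 - 5 * k e + 2 * (G.adjInd e a * G.adjInd e c)
        + 2 * (G.adjInd e b * G.adjInd e d) := by
      intro e
      have e1 := C.adjInd_mul_eq_zero hCab e
      have e2 := C.adjInd_mul_eq_zero hCbc e
      have e3 := C.adjInd_mul_eq_zero hCcd e
      have e4 := C.adjInd_mul_eq_zero (x := a) (y := d) (by omega) e
      have f1 := G.adjInd_mul_self e a
      have f2 := G.adjInd_mul_self e b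
      have f3 := G.adjInd_mul_self e c
      have f4 := G.adjInd_mul_self e d
      simp only [k]
      linear_combination f1 + f2 + f3 + f4 + 2 * e1 + 2 * e2 + 2 * e3 + 2 * e4
    simp only [h1, Finset.sum_sub_distrib, sum_s, ka, kb, kc, kd]
    simp only [h2, k, Finset.sum_add_distrib, Finset.sum_sub_distrib, ← Finset.mul_sum,
      sum_adjInd' hreg, Finset.sum_const, Finset.card_univ, nsmul_eq_mul, ← hn]
    linear_combination (-2) * hε
  rw [hD, hD2] at key
  simp only [r, and_assoc] at key ⊢
  rw [key]
  linear_combination 4 * hε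

/-- Sum over oriented paths `abcd` of a function of the path. -/
theorem sum_paths_linear [Fintype V] [DecidableEq V] (hreg : G.IsRegularOfDegree 3)
    (C : G.Coloring (Fin 2)) (α β γ L : ℤ)
    (hL : L = ∑ a, ∑ b, if G.Adj a b then ∑ c, if G.Adj b c ∧ a ≠ c then ∑ d,
        if G.Adj c d ∧ G.Adj d a ∧ b ≠ d then 1 else 0 else 0 else 0) :
    (∑ a, ∑ b, if G.Adj a b then ∑ c, if G.Adj b c ∧ a ≠ c then ∑ d,
        if G.Adj c d ∧ b ≠ d ∧ a ≠ d then
          α + β * G.adjInd a d - γ * ∑ v, G.adjInd v a * G.adjInd v c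
            - γ * ∑ v, G.adjInd v b * G.adjInd v d else 0 else 0 else 0) =
      12 * Fintype.card V * α + β * L - 4 * γ * (L + 6 * Fintype.card V) := by
  set n : ℤ := (Fintype.card V : ℤ) with hn
  have push : ∀ (P : Prop) [Decidable P] (φ : V → ℤ),
      (if P then ∑ x, φ x else 0) = ∑ x, if P then φ x else 0 := by
    intro P _ φ
    split_ifs <;> simp
  let q : V → V → V → ℤ := fun a b c ↦
    G.adjInd a b * G.adjInd b c * (1 - if c = a then 1 else 0)
  let p : V → V → V → V → ℤ := fun a b c d ↦
    q a b c * (G.adjInd c d * (1 - if d = b then 1 else 0))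
  let X : V → V → ℤ := fun x y ↦ ∑ v, G.adjInd v x * G.adjInd v y
  have hqs : ∀ a b c, q a b c = q c b a := by
    intro a b c
    simp only [q, G.adjInd_comm a b, G.adjInd_comm b c, eq_comm (a := c) (b := a)]
    ring
  have hps : ∀ a b c d, p a b c d = q b c d * (G.adjInd b a * (1 - if a = c then 1 else 0)) := by
    intro a b c d
    simp only [p, q, G.adjInd_comm a b, eq_comm (a := c) (b := a)]
    ring
  have hqq : ∀ a b c, q a b c * G.adjInd c b = q a b c := by
    intro a b c
    simp only [q, G.adjInd_comm c b]
    linear_combination (G.adjInd a b * (1 - if c = a then 1 else 0)) * G.adjInd_mul_self b c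
  have hsub : ∀ x y, ∑ d, G.adjInd x d * (1 - if d = y then 1 else 0) = 3 - G.adjInd x y := by
    intro x y
    simp [mul_sub, Finset.sum_sub_distrib, sum_adjInd hreg]
  have hp_d : ∀ a b c, ∑ d, p a b c d = 2 * q a b c := by
    intro a b c
    simp only [p, ← Finset.mul_sum, hsub]
    linear_combination -hqq a b c
  have hp_a : ∀ b c d, ∑ a, p a b c d = 2 * q b c d := by
    intro b c d
    simp only [hps, ← Finset.mul_sum, hsub]
    have := hqq d c b
    rw [← hqs b c d] at this
    linear_combination -this
  have hq : ∑ a, ∑ b, ∑ c, q a b c = 6 * n := by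
    have : ∀ a b, ∑ c, q a b c = 2 * G.adjInd a b := by
      intro a b
      simp only [q, mul_assoc, ← Finset.mul_sum, hsub, G.adjInd_comm b a]
      linear_combination -G.adjInd_mul_self a b
    simp only [this, ← Finset.mul_sum, sum_adjInd hreg, Finset.sum_const, Finset.card_univ,
      nsmul_eq_mul, ← hn]
    ring
  have hp : ∑ a, ∑ b, ∑ c, ∑ d, p a b c d = 12 * n := by
    simp only [hp_d, ← Finset.mul_sum, hq]
    ring
  have hLp : L = ∑ a, ∑ b, ∑ c, ∑ d, p a b c d * G.adjInd a d := by
    rw [hL]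
    refine Finset.sum_congr rfl fun a _ ↦ Finset.sum_congr rfl fun b _ ↦ ?_
    simp only [push]
    refine Finset.sum_congr rfl fun c _ ↦ Finset.sum_congr rfl fun d _ ↦ ?_
    simp only [p, q, adjInd, G.adj_comm d a, eq_comm (a := c) (b := a), eq_comm (a := d) (b := b)]
    by_cases h1 : G.Adj a b <;> by_cases h2 : G.Adj b c <;> by_cases h3 : a = c <;>
      by_cases h4 : G.Adj c d <;> by_cases h5 : b = d <;> by_cases h6 : G.Adj a d <;>
      simp [h1, h2, h3, h4, h5, h6]
  have hqX : ∑ a, ∑ b, ∑ c, q a b c * X a c = L + 6 * n := by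
    rw [hLp, ← hq]
    simp only [← Finset.sum_add_distrib]
    refine Finset.sum_congr rfl fun a _ ↦ Finset.sum_congr rfl fun b _ ↦
      Finset.sum_congr rfl fun c _ ↦ ?_
    have h1 : ∀ d, p a b c d * G.adjInd a d = q a b c * (G.adjInd d a * G.adjInd d c)
        - if d = b then q a b c * G.adjInd c b * G.adjInd a b else 0 := by
      intro d
      simp only [p, G.adjInd_comm d a, G.adjInd_comm d c]
      split_ifs with h
      · subst h
        ring
      · ring
    have h2 : q a b c * G.adjInd a b = q a b c := by
      have := hqq c b a
      rwa [← hqs a b c] at this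
    simp only [h1, Finset.sum_sub_distrib, Finset.sum_ite_eq', Finset.mem_univ, if_true,
      ← Finset.mul_sum, hqq, h2, X]
    ring
  have hpX : ∑ a, ∑ b, ∑ c, ∑ d, p a b c d * X a c = 2 * (L + 6 * n) := by
    simp only [← Finset.sum_mul, hp_d, mul_assoc, ← Finset.mul_sum, hqX]
  have hpY : ∑ a, ∑ b, ∑ c, ∑ d, p a b c d * X b d = 2 * (L + 6 * n) := by
    rw [Finset.sum_comm, ← hqX, Finset.mul_sum]
    refine Finset.sum_congr rfl fun b _ ↦ ?_
    rw [Finset.sum_comm, Finset.mul_sum]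
    refine Finset.sum_congr rfl fun c _ ↦ ?_
    rw [Finset.sum_comm, Finset.mul_sum]
    refine Finset.sum_congr rfl fun d _ ↦ ?_
    rw [← Finset.sum_mul, hp_a]
    ring
  have main : ∀ a b, (if G.Adj a b then ∑ c, if G.Adj b c ∧ a ≠ c then ∑ d,
        if G.Adj c d ∧ b ≠ d ∧ a ≠ d then
          α + β * G.adjInd a d - γ * ∑ v, G.adjInd v a * G.adjInd v c
            - γ * ∑ v, G.adjInd v b * G.adjInd v d else 0 else 0 else 0) =
      ∑ c, ∑ d, (α * p a b c d + β * (p a b c d * G.adjInd a d) - γ * (p a b c d * X a c)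
        - γ * (p a b c d * X b d)) := by
    intro a b
    simp only [push]
    refine Finset.sum_congr rfl fun c _ ↦ Finset.sum_congr rfl fun d _ ↦ ?_
    by_cases h : G.Adj a b ∧ G.Adj b c ∧ a ≠ c ∧ G.Adj c d ∧ b ≠ d
    · obtain ⟨h1, h2, h3, h4, h5⟩ := h
      have h6 : a ≠ d := by
        rintro rfl
        have := C.valid h1
        have := C.valid h2
        have := C.valid h4
        omega
      have hp1 : p a b c d = 1 := by
        simp [p, q, adjInd, h1, h2, h4, h3.symm, h5.symm]
      rw [if_pos h1, if_pos ⟨h2, h3⟩, if_pos ⟨h4, h5, h6⟩, hp1]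
      simp only [X]
      ring
    · have hp0 : p a b c d = 0 := by
        by_contra hp0
        refine h ?_
        simp only [p, q, adjInd, mul_ne_zero_iff, sub_ne_zero, ne_eq, ite_eq_right_iff,
          one_ne_zero] at hp0
        grind
      rw [hp0]
      split_ifs <;> first | (exfalso; tauto) | ring
  simp only [main, Finset.sum_add_distrib, Finset.sum_sub_distrib, ← Finset.mul_sum, hp, ← hLp,
    hpX, hpY]
  ring

end SimpleGraph

theorem stmt_12 {V : Type*} [Fintype V] [DecidableEq V] (G : SimpleGraph V) [DecidableRel G.Adj]
    (hreg : G.IsRegularOfDegree 3) (hbip : G.Colorable 2) (h : ℕ)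
    (hcard : Fintype.card V = 2 * h + 8)
    (hsix : numSubgraphs G (cycleGraph 4) = 6)
    (hshare : ∀ H₁ H₂ : G.Subgraph, Nonempty (H₁.coe ≃g cycleGraph 4) →
      Nonempty (H₂.coe ≃g cycleGraph 4) → H₁ ≠ H₂ →
      (H₁.edgeSet ∩ H₂.edgeSet).ncard ≤ 1) :
    numSubgraphs G (pathGraph 4 ⊕g pathGraph 2 ⊕g pathGraph 2) = 54 * h ^ 3 + 234 * h ^ 2 + 180 * h + 72 := by
  obtain ⟨C⟩ := hbip
  have hL : (48 : ℤ) = ∑ a, ∑ b, if G.Adj a b then ∑ c, if G.Adj b c ∧ a ≠ c then ∑ d,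
        if G.Adj c d ∧ G.Adj d a ∧ b ≠ d then 1 else 0 else 0 else 0 := by
    have := natCard_copy_eq G (cycleGraph 4)
    rw [natCard_copy_cycleGraph_four_self, hsix, natCard_copy_cycleGraph_four] at this
    have := congrArg (Nat.cast : ℕ → ℤ) this
    push_cast at this
    rw [this]
  have hN := natCard_copy_eq G (pathGraph 4 ⊕g pathGraph 2 ⊕g pathGraph 2)
  rw [natCard_copy_path_edge_edge_self, natCard_copy_path_edge_edge] at hN
  have hN' := congrArg (Nat.cast : ℕ → ℤ) hN
  push_cast at hN'
  have hsum := sum_paths_linear hreg C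
    ((3 * Fintype.card V - 18) * (3 * Fintype.card V - 16) - 36 * Fintype.card V + 280)
    (12 * Fintype.card V - 88) 8 48 hL
  have hcongr : ∀ a b c d, G.Adj a b → G.Adj b c ∧ a ≠ c → G.Adj c d ∧ b ≠ d ∧ a ≠ d → _ :=
    fun a b c d hab hbc hcd ↦ sum_disjoint_darts_avoiding_path hreg C hab hbc.1 hcd.1 hbc.2
      hcd.2.1 hcd.2.2
  have hfinal := hN'.symm.trans <| Eq.trans (by
    refine Finset.sum_congr rfl fun a _ ↦ Finset.sum_congr rfl fun b _ ↦ ?_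
    refine if_ctx_congr Iff.rfl (fun hab ↦ Finset.sum_congr rfl fun c _ ↦ ?_) fun _ ↦ rfl
    refine if_ctx_congr Iff.rfl (fun hbc ↦ Finset.sum_congr rfl fun d _ ↦ ?_) fun _ ↦ rfl
    exact if_ctx_congr Iff.rfl (fun hcd ↦ hcongr a b c d hab hbc hcd) fun _ ↦ rfl) hsum
  rw [hcard] at hfinal
  push_cast at hfinal
  zify
  linarith
end
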